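/- arXiv:2010.08448 — 6 statements merged into one kernel-verified Lean document; each statement's English description precedes it below -/
import Mathlib

section
/- Let L ≥ 0 and let F : ℝ² → ℝ be locally integrable such that for every y ∈ ℝ the function x ↦ F(x,y) is Lipschitz with constant L. Then for every pair of bounded intervals I = [a,b) and J = [c,d) with a<b and c<d, |⟨F, h_{I×J}⟩| ≤ L · |I|^{3/2} · |J|^{1/2}. -/
open MeasureTheory Set
open scoped ENNReal NNReal

noncomputable section

/-- L²-normalized Haar wavelet of the interval `[a, b)`. -/
def haarW (a b : ℝ) (x : ℝ) : ℝ :=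
  (Real.sqrt (b - a))⁻¹ *
    ((Ico a ((a + b) / 2)).indicator 1 x - (Ico ((a + b) / 2) b).indicator 1 x)

/-- Haar coefficient of `F : ℝ² → ℝ` on the rectangle `[a,b) × [c,d)`. -/
def haarCoef2 (F : ℝ × ℝ → ℝ) (a b c d : ℝ) : ℝ :=
  ∫ p : ℝ × ℝ, F p * (haarW a b p.1 * haarW c d p.2)

/-- Left endpoint of the dyadic interval `2^k • [j, j+1)`. -/
def dyadL (k j : ℤ) : ℝ := (2:ℝ) ^ k * (j : ℝ)

/-- Right endpoint of the dyadic interval `2^k • [j, j+1)`. -/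
def dyadR (k j : ℤ) : ℝ := (2:ℝ) ^ k * ((j : ℝ) + 1)

theorem abs_haarW_le (a b x : ℝ) :
    |haarW a b x| ≤ (Ico a b).indicator (fun _ => (Real.sqrt (b - a))⁻¹) x := by
  have hs : 0 ≤ (Real.sqrt (b - a))⁻¹ := by positivity
  rw [haarW, abs_mul, abs_of_nonneg hs]
  simp only [indicator_apply, mem_Ico, Pi.one_apply]
  split_ifs <;> first | (simp; done) | simpa using hs | (exfalso; grind)

theorem integral_Ico_indicator_const {a b : ℝ} (hab : a ≤ b) (C : ℝ) :
    ∫ x, (Ico a b).indicator (fun _ => C) x = (b - a) * C := by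
  simp [integral_indicator measurableSet_Ico, hab]

theorem integrable_Ico_indicator_const (a b C : ℝ) :
    Integrable ((Ico a b).indicator fun _ => C) :=
  (integrable_indicator_iff measurableSet_Ico).2 (integrableOn_const (by simp))

theorem integrable_haarW (a b : ℝ) : Integrable (haarW a b) :=
  ((integrable_Ico_indicator_const _ _ 1).sub (integrable_Ico_indicator_const _ _ 1)).const_mul _

theorem integral_haarW {a b : ℝ} (hab : a ≤ b) : ∫ x, haarW a b x = 0 := by
  have h : ∫ x, haarW a b x = (Real.sqrt (b - a))⁻¹ *
      (∫ x, (Ico a ((a + b) / 2)).indicator (fun _ => (1 : ℝ)) x -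
        (Ico ((a + b) / 2) b).indicator (fun _ => (1 : ℝ)) x) :=
    integral_const_mul _ _
  rw [h, integral_sub (integrable_Ico_indicator_const _ _ 1)
    (integrable_Ico_indicator_const _ _ 1), integral_Ico_indicator_const (by linarith),
    integral_Ico_indicator_const (by linarith)]
  ring

/-- The one-dimensional Haar coefficient of a Lipschitz function gains a factor of the length. -/
theorem abs_integral_mul_haarW_le {L : ℝ} (hL : 0 ≤ L) {f : ℝ → ℝ}
    (hf : ∀ x x', |f x - f x'| ≤ L * |x - x'|) {a b : ℝ} (hab : a ≤ b) :
    |∫ x, f x * haarW a b x| ≤ L * (b - a) * Real.sqrt (b - a) := by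
  have hba : 0 ≤ b - a := sub_nonneg.2 hab
  by_cases hi : Integrable fun x => f x * haarW a b x
  · have h : ∫ x, f x * haarW a b x = ∫ x, (f x - f a) * haarW a b x := by
      simp_rw [sub_mul]
      rw [integral_sub hi ((integrable_haarW a b).const_mul _), integral_const_mul,
        integral_haarW hab, mul_zero, sub_zero]
    rw [h, ← Real.norm_eq_abs]
    refine (norm_integral_le_of_norm_le (integrable_Ico_indicator_const a b
      (L * (b - a) * (Real.sqrt (b - a))⁻¹)) (.of_forall fun x => ?_)).trans_eq ?_
    · rw [Real.norm_eq_abs, abs_mul]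
      have hW := abs_haarW_le a b x
      by_cases hx : x ∈ Ico a b
      · rw [indicator_of_mem hx] at hW ⊢
        have hxa : |x - a| ≤ b - a := by
          rw [abs_of_nonneg (sub_nonneg.2 hx.1)]
          linarith [hx.2]
        have := (hf x a).trans (mul_le_mul_of_nonneg_left hxa hL)
        gcongr
      · rw [indicator_of_notMem hx] at hW ⊢
        rw [le_antisymm hW (abs_nonneg _), mul_zero]
    · rw [integral_Ico_indicator_const hab]
      calc _ = L * (b - a) * ((b - a) / Real.sqrt (b - a)) := by ring
        _ = _ := by rw [Real.div_sqrt]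
  · rw [integral_undef hi, abs_zero]
    positivity

/-- The `p = ∞, s = 1` endpoint in the proof of Lemma 2.2: integration by parts in the
first variable gains a full factor of `|I|` over the trivial bound. -/
theorem haar_coefficient_lipschitz_bound (L : ℝ) (hL : 0 ≤ L) (F : ℝ × ℝ → ℝ)
    (hloc : LocallyIntegrable F volume)
    (hlip : ∀ y x x' : ℝ, |F (x, y) - F (x', y)| ≤ L * |x - x'|)
    (a b c d : ℝ) (hab : a < b) (hcd : c < d) :
    |haarCoef2 F a b c d| ≤ L * (b - a) ^ ((3:ℝ)/2) * (d - c) ^ ((1:ℝ)/2) := by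
  have hba : 0 ≤ b - a := sub_nonneg.2 hab.le
  have hpow : (b - a) ^ ((3 : ℝ) / 2) = (b - a) * Real.sqrt (b - a) := by
    rw [show (3 : ℝ) / 2 = 1 + 1 / 2 by norm_num, Real.rpow_add (sub_pos.2 hab), Real.rpow_one,
      Real.sqrt_eq_rpow]
  rw [hpow, ← Real.sqrt_eq_rpow, ← mul_assoc, haarCoef2]
  by_cases hi : Integrable fun p : ℝ × ℝ => F p * (haarW a b p.1 * haarW c d p.2)
  · rw [Measure.volume_eq_prod] at hi ⊢
    rw [integral_prod_symm _ hi, ← Real.norm_eq_abs]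
    refine (norm_integral_le_of_norm_le (integrable_Ico_indicator_const c d
      (L * (b - a) * Real.sqrt (b - a) * (Real.sqrt (d - c))⁻¹))
      (.of_forall fun y => ?_)).trans_eq ?_
    · simp_rw [← mul_assoc]
      rw [integral_mul_const, Real.norm_eq_abs, abs_mul]
      calc _ ≤ L * (b - a) * Real.sqrt (b - a) *
            (Ico c d).indicator (fun _ => (Real.sqrt (d - c))⁻¹) y := by
            gcongr
            · exact abs_integral_mul_haarW_le hL (hlip y) hab.le
            · exact abs_haarW_le c d y
        _ = _ := (indicator_const_mul _ _ _ _).symm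
    · rw [integral_Ico_indicator_const hcd.le]
      calc _ = L * (b - a) * Real.sqrt (b - a) * ((d - c) / Real.sqrt (d - c)) := by ring
        _ = _ := by rw [Real.div_sqrt]
  · rw [integral_undef hi, abs_zero]
    positivity
end
end

section
/- For every θ ∈ (0, π/2), let S := {(x,y) ∈ ℝ² : −x·tanθ ≤ y ≤ −x·tanθ + 1/sinθ}. Then there exists a dyadic rectangle R = I×J (I, J ∈ 𝔻) such that |⟨𝟙_S, h_R⟩| ≥ |R|^{1/2}/16; equivalently, the normalized Haar coefficient satisfies |R|^{−1/2}·|⟨𝟙_S, h_R⟩| ≥ 1/16. -/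
open MeasureTheory Set
open scoped ENNReal NNReal

noncomputable section

theorem integrable_indicator_Ico_one (c d : ℝ) : Integrable ((Ico c d).indicator (1 : ℝ → ℝ)) :=
  (integrable_indicator_iff measurableSet_Ico).2 (integrableOn_const (by simp))

theorem measurableSet_slanted_strip (t w : ℝ) :
    MeasurableSet {q : ℝ × ℝ | -q.1 * t ≤ q.2 ∧ q.2 ≤ -q.1 * t + w} :=
  .inter (measurableSet_le (f := fun q : ℝ × ℝ ↦ -q.1 * t) (by fun_prop) measurable_snd)
    (measurableSet_le (g := fun q : ℝ × ℝ ↦ -q.1 * t + w) measurable_snd (by fun_prop))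

/-- Fubini for the Haar coefficient of an indicator function. -/
theorem haarCoef2_indicator {S : Set (ℝ × ℝ)} (hS : MeasurableSet S) (a b c d : ℝ) :
    haarCoef2 (S.indicator 1) a b c d =
      ∫ x, haarW a b x * ∫ y, S.indicator 1 (x, y) * haarW c d y := by
  have hint : Integrable fun p : ℝ × ℝ ↦
      S.indicator (1 : ℝ × ℝ → ℝ) p * (haarW a b p.1 * haarW c d p.2) := by
    refine (((integrable_haarW a b).mul_prod (integrable_haarW c d)).indicator hS).congr
      (.of_forall fun p ↦ ?_)
    by_cases hp : p ∈ S <;> simp [hp]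
  rw [haarCoef2, Measure.volume_eq_prod, integral_prod _ hint]
  simp only [← integral_const_mul]
  congr! 4
  ring

/-- A strip whose lower edge leaves `[0, 1)` through its lower half pairs with the Haar wavelet
of `[0, 1)` to minus the height of that edge. -/
theorem integral_strip_mul_haarW {t w x : ℝ} (hw : 1 ≤ w) (hx₀ : 0 ≤ -x * t)
    (hx : -x * t ≤ 1 / 2) :
    ∫ y, {q : ℝ × ℝ | -q.1 * t ≤ q.2 ∧ q.2 ≤ -q.1 * t + w}.indicator 1 (x, y) * haarW 0 1 y
      = x * t := by
  have key (y : ℝ) :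
      {q : ℝ × ℝ | -q.1 * t ≤ q.2 ∧ q.2 ≤ -q.1 * t + w}.indicator 1 (x, y) * haarW 0 1 y
        = (Ico (-x * t) (1 / 2)).indicator (1 : ℝ → ℝ) y
          - (Ico (1 / 2) 1).indicator (1 : ℝ → ℝ) y := by
    simp only [haarW, indicator_apply, mem_ofPred_eq, mem_Ico, Pi.one_apply, sub_zero,
      Real.sqrt_one, inv_one, zero_add]
    split_ifs <;> grind
  simp only [key]
  rw [integral_sub (integrable_indicator_Ico_one _ _) (integrable_indicator_Ico_one _ _),
    integral_indicator_one measurableSet_Ico,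
    integral_indicator_one measurableSet_Ico, Real.volume_real_Ico_of_le hx,
    Real.volume_real_Ico_of_le (by norm_num)]
  ring

theorem integral_haarW_mul_linear {K : ℝ} (hK : 0 < K) (t : ℝ) :
    ∫ x, haarW (-K) 0 x * (x * t) = -(√K * (K * t) / 4) := by
  have h (c d : ℝ) : Integrable ((Ico c d).indicator fun x ↦ x * t) :=
    (integrable_indicator_iff measurableSet_Ico).2
      ((Continuous.integrableOn_Icc (by fun_prop)).mono_set Ico_subset_Icc_self)
  have hI {c d : ℝ} (hcd : c ≤ d) :
      ∫ x, (Ico c d).indicator (fun x ↦ x * t) x = (d ^ 2 - c ^ 2) / 2 * t := by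
    rw [integral_indicator measurableSet_Ico, integral_Ico_eq_integral_Ioc,
      ← intervalIntegral.integral_of_le hcd, intervalIntegral.integral_mul_const, integral_id]
  have key (x : ℝ) : haarW (-K) 0 x * (x * t) = (√K)⁻¹ *
      ((Ico (-K) (-K / 2)).indicator (fun x ↦ x * t) x
        - (Ico (-K / 2) 0).indicator (fun x ↦ x * t) x) := by
    simp only [haarW, indicator_apply, Pi.one_apply, sub_neg_eq_add, zero_add, add_zero]
    split_ifs <;> ring
  simp only [key]
  rw [integral_const_mul, integral_sub (h _ _) (h _ _), hI (by linarith), hI (by linarith)]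
  have hs : √K ≠ 0 := (Real.sqrt_pos.2 hK).ne'
  field_simp
  rw [Real.sq_sqrt hK.le]
  ring

theorem haarW_eq_zero {a b x : ℝ} (hab : a ≤ b) (hx : x ∉ Ico a b) : haarW a b x = 0 := by
  simp only [haarW, indicator_apply, mem_Ico, Pi.one_apply] at *
  split_ifs <;> grind

/-- The counterexample of Section 3.1: the indicator of the rotated strip `S` has a
uniformly large normalized rectangular Haar coefficient. -/
theorem rotated_strip_large_coefficient (θ : ℝ) (hθ : θ ∈ Ioo 0 (Real.pi/2)) :
    ∃ k₁ j₁ k₂ j₂ : ℤ,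
      Real.sqrt ((2:ℝ) ^ k₁ * (2:ℝ) ^ k₂) / 16 ≤
        |haarCoef2
          (({q : ℝ × ℝ | -q.1 * Real.tan θ ≤ q.2 ∧
              q.2 ≤ -q.1 * Real.tan θ + (Real.sin θ)⁻¹}).indicator 1)
          (dyadL k₁ j₁) (dyadR k₁ j₁) (dyadL k₂ j₂) (dyadR k₂ j₂)| := by
  have ht : 0 < Real.tan θ := Real.tan_pos_of_pos_of_lt_pi_div_two hθ.1 hθ.2
  have hs : 1 ≤ (Real.sin θ)⁻¹ :=
    (one_le_inv₀ (Real.sin_pos_of_pos_of_lt_pi hθ.1 (by linarith [hθ.1, hθ.2]))).2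
      (Real.sin_le_one θ)
  set t := Real.tan θ
  obtain ⟨k, hk₁, hk₂⟩ := exists_mem_Ico_zpow (y := (2 : ℝ)) (x := 1 / (2 * t)) (by positivity)
    (by norm_num)
  rw [zpow_add_one₀ two_ne_zero, div_lt_iff₀ (by positivity)] at hk₂
  rw [le_div_iff₀ (by positivity)] at hk₁
  have hK : (0 : ℝ) < 2 ^ k := by positivity
  refine ⟨k, -1, 0, 0, ?_⟩
  simp only [dyadL, dyadR, Int.cast_neg, Int.cast_one, Int.cast_zero, zpow_zero, mul_zero,
    zero_add, mul_one, mul_neg, neg_add_cancel]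
  set K : ℝ := 2 ^ k
  have key (x : ℝ) : haarW (-K) 0 x * ∫ y, {q : ℝ × ℝ | -q.1 * t ≤ q.2 ∧
      q.2 ≤ -q.1 * t + (Real.sin θ)⁻¹}.indicator 1 (x, y) * haarW 0 1 y
        = haarW (-K) 0 x * (x * t) := by
    by_cases hx : x ∈ Ico (-K) 0
    · rw [integral_strip_mul_haarW hs (by nlinarith [hx.2]) (by nlinarith [hx.1])]
    · simp [haarW_eq_zero (by linarith) hx]
  rw [haarCoef2_indicator (measurableSet_slanted_strip _ _)]
  simp only [key]
  rw [integral_haarW_mul_linear hK, abs_neg, abs_of_nonneg (by positivity)]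
  nlinarith [Real.sqrt_nonneg K]
end
end

section
/- Let f : ℝ → ℝ be continuously differentiable with compact support. For α > 0 define G_α : ℝ → ℝ by G_α(y) := α·|y|^{−α−1} for |y| > 1 and G_α(y) := 0 for |y| ≤ 1. Then there exists a constant C = C(f) such that for every p ∈ [2,∞), with α := 2/p: ‖(x,y) ↦ f(x)·g_α(y)‖_{L^p(ℝ²)} + ‖(x,y) ↦ f′(x)·g_α(y)‖_{L^p(ℝ²)} + ‖(x,y) ↦ f(x)·G_α(y)‖_{L^p(ℝ²)} ≤ C. -/
open MeasureTheory Set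
open scoped ENNReal

noncomputable section

/-- The function `g_α`: equal to `1` on `[-1,1]` and to `|y|^{-α}` outside. -/
def gFun (α : ℝ) (y : ℝ) : ℝ := if |y| ≤ 1 then 1 else |y| ^ (-α)

/-- The function `G_α`: equal to `0` on `[-1,1]` and to `α·|y|^{-α-1}` outside
(the modulus of the weak derivative of `g_α`). -/
def GFun (α : ℝ) (y : ℝ) : ℝ := if |y| ≤ 1 then 0 else α * |y| ^ (-α - 1)

lemma gFun_nonneg (α y : ℝ) : 0 ≤ gFun α y := by
  unfold gFun
  split_ifs <;> positivity

lemma gFun_rpow_le {p : ℝ} (hp : 0 < p) (y : ℝ) :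
    gFun (2 / p) y ^ p ≤ 2 * (1 + y ^ 2)⁻¹ := by
  rw [← div_eq_mul_inv, le_div_iff₀ (by positivity), gFun, ← sq_abs y]
  split_ifs with h
  · have := abs_nonneg y
    rw [Real.one_rpow]
    nlinarith
  · push Not at h
    have hy : 0 < |y| := one_pos.trans h
    rw [← Real.rpow_mul hy.le, neg_mul, div_mul_cancel₀ _ hp.ne', Real.rpow_neg hy.le,
      Real.rpow_two, inv_mul_le_iff₀ (by positivity)]
    nlinarith

lemma abs_GFun_le_gFun {α : ℝ} (h0 : 0 ≤ α) (h1 : α ≤ 1) (y : ℝ) :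
    |GFun α y| ≤ gFun α y := by
  unfold GFun gFun
  split_ifs with h
  · simp
  · push Not at h
    have hy : 0 < |y| := one_pos.trans h
    rw [abs_of_nonneg (by positivity)]
    calc α * |y| ^ (-α - 1) ≤ 1 * |y| ^ (-α) := by
          gcongr
          · exact h.le
          · linarith
      _ = |y| ^ (-α) := one_mul _

/-- The `L^p(ℝ²)` norms of `u(x)·k(y)`, where `u` is continuous with compact support and
`|k| ≤ g_{2/p}`, are bounded uniformly in `p ≥ 1`. -/
lemma exists_eLpNorm_mul_le {u : ℝ → ℝ} (hu : Continuous u) (hc : HasCompactSupport u) :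
    ∃ C : ℝ≥0∞, C ≠ ∞ ∧ ∀ p : ℝ, 1 ≤ p → ∀ k : ℝ → ℝ, (∀ y, |k y| ≤ gFun (2 / p) y) →
      eLpNorm (fun q : ℝ × ℝ => u q.1 * k q.2) (ENNReal.ofReal p) volume ≤ C := by
  obtain ⟨M, hM⟩ := hc.exists_bound_of_continuous hu
  set A : ℝ≥0∞ := volume (tsupport u) * ∫⁻ y : ℝ, ENNReal.ofReal (2 * (1 + y ^ 2)⁻¹)
  have hA_top : A ≠ ∞ := ENNReal.mul_ne_top hc.isCompact.measure_lt_top.ne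
    (integrable_inv_one_add_sq.const_mul 2).lintegral_lt_top.ne
  refine ⟨ENNReal.ofReal M * max 1 A, ENNReal.mul_ne_top ENNReal.ofReal_ne_top (by simp [hA_top]),
    fun p hp k hk => ?_⟩
  have hp0 : 0 < p := one_pos.trans_le hp
  have hpt : ∀ q : ℝ × ℝ, ‖u q.1 * k q.2‖ₑ ^ p ≤ ENNReal.ofReal M ^ p *
      ((tsupport u).indicator 1 q.1 * ENNReal.ofReal (2 * (1 + q.2 ^ 2)⁻¹)) := by
    rintro ⟨x, y⟩
    by_cases hx : x ∈ tsupport u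
    · rw [enorm_mul, ENNReal.mul_rpow_of_nonneg _ _ hp0.le, indicator_of_mem hx, Pi.one_apply,
        one_mul]
      gcongr
      · rw [← ofReal_norm]
        exact ENNReal.ofReal_le_ofReal (hM x)
      · rw [← ofReal_norm, ENNReal.ofReal_rpow_of_nonneg (norm_nonneg _) hp0.le]
        exact ENNReal.ofReal_le_ofReal
          ((Real.rpow_le_rpow (norm_nonneg _) (hk y) hp0.le).trans (gFun_rpow_le hp0 y))
    · simp [image_eq_zero_of_notMem_tsupport hx, hp0]
  rw [eLpNorm_eq_lintegral_rpow_enorm_toReal (by simpa using hp0) ENNReal.ofReal_ne_top,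
    ENNReal.toReal_ofReal hp0.le]
  have hint : ∫⁻ q : ℝ × ℝ, ‖u q.1 * k q.2‖ₑ ^ p ≤ ENNReal.ofReal M ^ p * A := by
    refine (lintegral_mono hpt).trans_eq ?_
    have hmeas : MeasurableSet (tsupport u) := (isClosed_tsupport u).measurableSet
    rw [lintegral_const_mul' _ _ (by simp [hp0.le]), Measure.volume_eq_prod,
      lintegral_prod_mul (g := fun y : ℝ => ENNReal.ofReal (2 * (1 + y ^ 2)⁻¹))
        (measurable_one.indicator hmeas).aemeasurable (by fun_prop),
      lintegral_indicator_one hmeas]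
  calc (∫⁻ q : ℝ × ℝ, ‖u q.1 * k q.2‖ₑ ^ p) ^ (1 / p)
      ≤ (ENNReal.ofReal M ^ p * A) ^ (1 / p) := by gcongr
    _ = ENNReal.ofReal M * A ^ (1 / p) := by
        rw [ENNReal.mul_rpow_of_nonneg _ _ (by positivity), ← ENNReal.rpow_mul,
          mul_one_div_cancel hp0.ne', ENNReal.rpow_one]
    _ ≤ ENNReal.ofReal M * max 1 A := by
        gcongr
        calc A ^ (1 / p) ≤ max 1 A ^ (1 / p) := by gcongr; exact le_max_right _ _
          _ ≤ max 1 A ^ (1 : ℝ) :=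
            ENNReal.rpow_le_rpow_of_exponent_le (le_max_left _ _) (by rwa [div_le_one hp0])
          _ = max 1 A := ENNReal.rpow_one _

/-- Lemma 3.2 of the paper (Property A): the `W^{1,p}` norms of
`F(x,y) = f(x)·g_{2/p}(y)` are bounded uniformly in `p ∈ [2,∞)`. -/
theorem counterexample_sobolev_uniform_bound (f : ℝ → ℝ)
    (hf : ContDiff ℝ 1 f) (hsupp : HasCompactSupport f) :
    ∃ C : ℝ, ∀ p : ℝ, 2 ≤ p →
      eLpNorm (fun q : ℝ × ℝ => f q.1 * gFun (2/p) q.2) (ENNReal.ofReal p) volume +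
        eLpNorm (fun q : ℝ × ℝ => deriv f q.1 * gFun (2/p) q.2) (ENNReal.ofReal p) volume +
        eLpNorm (fun q : ℝ × ℝ => f q.1 * GFun (2/p) q.2) (ENNReal.ofReal p) volume
        ≤ ENNReal.ofReal C := by
  obtain ⟨C₁, hC₁, h₁⟩ := exists_eLpNorm_mul_le hf.continuous hsupp
  obtain ⟨C₂, hC₂, h₂⟩ := exists_eLpNorm_mul_le (hf.continuous_deriv le_rfl) hsupp.deriv
  refine ⟨(C₁ + C₂ + C₁).toReal, fun p hp => ?_⟩
  rw [ENNReal.ofReal_toReal (by simp [hC₁, hC₂])]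
  have hp1 : 1 ≤ p := one_le_two.trans hp
  have hg : ∀ y, |gFun (2 / p) y| ≤ gFun (2 / p) y := fun y => (abs_of_nonneg (gFun_nonneg _ y)).le
  have hG : ∀ y, |GFun (2 / p) y| ≤ gFun (2 / p) y :=
    abs_GFun_le_gFun (by positivity) (by rwa [div_le_one (by positivity)])
  exact add_le_add (add_le_add (h₁ p hp1 _ hg) (h₂ p hp1 _ hg)) (h₁ p hp1 _ hG)
end
end

section
/- Let f : ℝ → ℝ be Lipschitz, supported in [1,2], with ∫_ℝ f = 0. There exists a constant C = C(f) such that for every p ∈ (4,∞), setting F(x,y) := f(x)·g_{2/p}(y), for every open set Ω ⊆ ℝ² with 0 < |Ω| < ∞: ( (1/|Ω|) · Σ_{I,J ∈ 𝔻, I×J ⊆ Ω} |⟨F, h_{I×J}⟩|² )^{1/2} ≤ C · p^{−1/4}. -/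
open MeasureTheory Set
open scoped ENNReal NNReal

noncomputable section

/-- The dyadic rectangle indexed by `q = ((k₁,j₁),(k₂,j₂))`. -/
def dyadRect (q : (ℤ × ℤ) × ℤ × ℤ) : Set (ℝ × ℝ) :=
  Ico (dyadL q.1.1 q.1.2) (dyadR q.1.1 q.1.2) ×ˢ Ico (dyadL q.2.1 q.2.2) (dyadR q.2.1 q.2.2)

/-- Haar coefficient of `F` on a dyadic rectangle. -/
def dyadCoef (F : ℝ × ℝ → ℝ) (q : (ℤ × ℤ) × ℤ × ℤ) : ℝ :=
  haarCoef2 F (dyadL q.1.1 q.1.2) (dyadR q.1.1 q.1.2) (dyadL q.2.1 q.2.2) (dyadR q.2.1 q.2.2)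

/-- One-parameter Haar coefficient in terms of the integrals over the two halves. -/
lemma integral_mul_haarW {f : ℝ → ℝ} (hf : Continuous f) {a b : ℝ} (hab : a ≤ b) :
    ∫ x, f x * haarW a b x =
      (Real.sqrt (b - a))⁻¹ * ((∫ x in a..(a + b) / 2, f x) - ∫ x in (a + b) / 2..b, f x) := by
  have h1 : a ≤ (a + b) / 2 := by linarith
  have h2 : (a + b) / 2 ≤ b := by linarith
  have hi : ∀ c d : ℝ, Integrable ((Ico c d).indicator f) := fun c d =>
    (integrable_indicator_iff measurableSet_Ico).2
      ((hf.integrableOn_Icc (a := c) (b := d)).mono_set Ico_subset_Icc_self)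
  have he : ∀ x, f x * haarW a b x = (Real.sqrt (b - a))⁻¹ *
      ((Ico a ((a + b) / 2)).indicator f x - (Ico ((a + b) / 2) b).indicator f x) := by
    intro x
    simp only [haarW, indicator, Pi.one_apply]
    split_ifs <;> ring
  simp_rw [he]
  rw [integral_const_mul, integral_sub (hi _ _) (hi _ _), integral_indicator measurableSet_Ico,
    integral_indicator measurableSet_Ico, intervalIntegral.integral_of_le h1,
    intervalIntegral.integral_of_le h2, integral_Ico_eq_integral_Ioc,
    integral_Ico_eq_integral_Ioc]

lemma sq_integral_mul_haarW_le {f : ℝ → ℝ} (hf : Continuous f) {a b M : ℝ} (hab : a < b)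
    (h : |(∫ x in a..(a + b) / 2, f x) - ∫ x in (a + b) / 2..b, f x| ≤ M * (b - a)) :
    (∫ x, f x * haarW a b x) ^ 2 ≤ M ^ 2 * (b - a) := by
  have hba : 0 < b - a := by linarith
  rw [integral_mul_haarW hf hab.le, mul_pow, inv_pow, Real.sq_sqrt hba.le]
  have h2 := pow_le_pow_left₀ (abs_nonneg _) h 2
  rw [sq_abs] at h2
  rw [inv_mul_le_iff₀ hba]
  linarith

/-- The Haar coefficient is controlled by the oscillation between the two halves. -/
lemma sq_integral_mul_haarW_le_of_abs_sub_le {f : ℝ → ℝ} (hf : Continuous f) {a b M : ℝ}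
    (hab : a < b)
    (h : ∀ x ∈ Icc a ((a + b) / 2), |f x - f (x + (b - a) / 2)| ≤ M) :
    (∫ x, f x * haarW a b x) ^ 2 ≤ M ^ 2 * (b - a) := by
  have hm : a ≤ (a + b) / 2 := by linarith
  have hM : 0 ≤ M := (abs_nonneg _).trans (h a ⟨le_rfl, hm⟩)
  apply sq_integral_mul_haarW_le hf hab
  have hs : ∫ x in (a + b) / 2..b, f x = ∫ x in a..(a + b) / 2, f (x + (b - a) / 2) := by
    rw [intervalIntegral.integral_comp_add_right]
    congr 1 <;> ring
  rw [hs, ← intervalIntegral.integral_sub (hf.intervalIntegrable _ _)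
    ((by fun_prop : Continuous fun x => f (x + (b - a) / 2)).intervalIntegrable _ _)]
  have := intervalIntegral.norm_integral_le_of_norm_le_const (a := a) (b := (a + b) / 2) (C := M)
    (f := fun x => f x - f (x + (b - a) / 2)) (by
      intro x hx
      rw [uIoc_of_le hm] at hx
      exact h x ⟨hx.1.le, hx.2⟩)
  rw [Real.norm_eq_abs] at this
  refine this.trans ?_
  rw [abs_of_nonneg (by linarith)]
  exact mul_le_mul_of_nonneg_left (by linarith) hM

lemma dyadR_sub_dyadL (k j : ℤ) : dyadR k j - dyadL k j = (2 : ℝ) ^ k := by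
  unfold dyadR dyadL; ring

lemma dyadL_lt_dyadR (k j : ℤ) : dyadL k j < dyadR k j := by
  have : (0 : ℝ) < 2 ^ k := by positivity
  linarith [dyadR_sub_dyadL k j]

lemma dyadCoef_mul (f g : ℝ → ℝ) (q : (ℤ × ℤ) × ℤ × ℤ) :
    dyadCoef (fun z : ℝ × ℝ => f z.1 * g z.2) q =
      (∫ x, f x * haarW (dyadL q.1.1 q.1.2) (dyadR q.1.1 q.1.2) x) *
        ∫ y, g y * haarW (dyadL q.2.1 q.2.2) (dyadR q.2.1 q.2.2) y := by
  rw [← integral_prod_mul]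
  unfold dyadCoef haarCoef2
  rw [← Measure.volume_eq_prod]
  congr 1
  ext z
  ring

lemma gFun_eq_max (α y : ℝ) : gFun α y = (max 1 |y|) ^ (-α) := by
  unfold gFun
  split_ifs with h
  · rw [max_eq_left h, Real.one_rpow]
  · rw [max_eq_right (not_le.1 h).le]

lemma continuous_gFun (α : ℝ) : Continuous (gFun α) := by
  have : gFun α = fun y => (max 1 |y|) ^ (-α) := funext (gFun_eq_max α)
  rw [this]
  exact Continuous.rpow_const (by fun_prop) fun y =>
    Or.inl (zero_lt_one.trans_le (le_max_left 1 |y|)).ne'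

lemma gFun_neg (α y : ℝ) : gFun α (-y) = gFun α y := by
  simp [gFun]

lemma gFun_of_one_le {α y : ℝ} (hy : 1 ≤ |y|) : gFun α y = |y| ^ (-α) := by
  rw [gFun_eq_max, max_eq_right hy]

lemma gFun_le_gFun {α x y : ℝ} (hα : 0 ≤ α) (h : |x| ≤ |y|) : gFun α y ≤ gFun α x := by
  rw [gFun_eq_max, gFun_eq_max]
  exact Real.rpow_le_rpow_of_nonpos (zero_lt_one.trans_le (le_max_left _ _))
    (max_le_max le_rfl h) (by linarith)

lemma rpow_neg_sub_rpow_neg_le {α u v : ℝ} (hα : 0 ≤ α) (hu : 0 < u) (huv : u ≤ v) :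
    u ^ (-α) - v ^ (-α) ≤ α * u ^ (-α) * ((v - u) / u) := by
  have hv : 0 < v := hu.trans_le huv
  have hvu : 0 < v / u := by positivity
  have h1 : v ^ (-α) = u ^ (-α) * (v / u) ^ (-α) := by
    rw [← Real.mul_rpow hu.le hvu.le, mul_div_cancel₀ _ hu.ne']
  have h2 : 1 - α * ((v - u) / u) ≤ (v / u) ^ (-α) := by
    rw [Real.rpow_def_of_pos hvu]
    have h3 := Real.add_one_le_exp (Real.log (v / u) * -α)
    have h4 := Real.log_le_sub_one_of_pos hvu
    have h5 : (v - u) / u = v / u - 1 := by field_simp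
    rw [h5]
    nlinarith [mul_le_mul_of_nonneg_left h4 hα]
  rw [h1]
  nlinarith [mul_le_mul_of_nonneg_left h2 (Real.rpow_nonneg hu.le (-α))]

lemma abs_rpow_neg_sub_rpow_neg_le {α t u v : ℝ} (hα : 0 ≤ α) (ht : 0 < t) (hu : t ≤ u)
    (hv : t ≤ v) : |u ^ (-α) - v ^ (-α)| ≤ α * t ^ (-α) * (|v - u| / t) := by
  wlog huv : u ≤ v generalizing u v
  · rw [abs_sub_comm, abs_sub_comm v u]
    exact this hv hu (not_le.1 huv).le
  have hu0 : 0 < u := ht.trans_le hu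
  have h0 : v ^ (-α) ≤ u ^ (-α) := Real.rpow_le_rpow_of_nonpos hu0 huv (by linarith)
  have h1 : u ^ (-α) ≤ t ^ (-α) := Real.rpow_le_rpow_of_nonpos ht hu (by linarith)
  have hd : 0 ≤ v - u := by linarith
  rw [abs_of_nonneg (by linarith), abs_of_nonneg hd]
  refine (rpow_neg_sub_rpow_neg_le hα hu0 huv).trans ?_
  gcongr

lemma abs_gFun_sub_gFun_le {α x y : ℝ} (hα : 0 ≤ α) :
    |gFun α x - gFun α y| ≤ α * |y - x| := by
  rw [gFun_eq_max, gFun_eq_max]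
  have h := abs_rpow_neg_sub_rpow_neg_le hα one_pos (le_max_left 1 |x|) (le_max_left 1 |y|)
  rw [Real.one_rpow, mul_one, div_one] at h
  refine h.trans (mul_le_mul_of_nonneg_left ?_ hα)
  have h1 := abs_max_sub_max_le_max (1 : ℝ) |y| 1 |x|
  rw [sub_self, abs_zero, max_eq_right (abs_nonneg (|y| - |x|))] at h1
  exact h1.trans (abs_abs_sub_abs_le _ _)

lemma abs_gFun_sub_gFun_le_of_le {α t x y : ℝ} (hα : 0 ≤ α) (ht : 1 ≤ t) (hx : t ≤ |x|)
    (hy : t ≤ |y|) (hxy : |y - x| ≤ t) : |gFun α x - gFun α y| ≤ α * t ^ (-α) := by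
  have ht0 : 0 < t := by linarith
  rw [gFun_of_one_le (ht.trans hx), gFun_of_one_le (ht.trans hy)]
  refine (abs_rpow_neg_sub_rpow_neg_le hα ht0 hx hy).trans ?_
  have h1 : |(|y| - |x|)| / t ≤ 1 :=
    (div_le_one ht0).2 ((abs_abs_sub_abs_le _ _).trans hxy)
  exact mul_le_of_le_one_right (mul_nonneg hα (Real.rpow_nonneg ht0.le _)) h1

/-- The two halves of the interval `[0, 2L)` carry almost the same mass of `g_α`. -/
lemma abs_integral_gFun_sub_le {α L : ℝ} (hα : 0 < α) (hα2 : α ≤ 1 / 2) (hL : 1 ≤ L) :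
    |(∫ x in (0 : ℝ)..L, gFun α x) - ∫ x in L..2 * L, gFun α x| ≤
      3 * α * (2 * L) ^ (-α) * (2 * L) := by
  have hL0 : 0 < L := by linarith
  have hc := continuous_gFun α
  have hgL : gFun α L = L ^ (-α) := by
    rw [gFun_of_one_le (by rwa [abs_of_pos hL0]), abs_of_pos hL0]
  have hg2L : gFun α (2 * L) = (2 * L) ^ (-α) := by
    rw [gFun_of_one_le (by rw [abs_of_pos] <;> linarith), abs_of_pos (by linarith)]
  have h1 : L * L ^ (-α) ≤ ∫ x in (0 : ℝ)..L, gFun α x := by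
    have := intervalIntegral.integral_mono_on hL0.le
      (intervalIntegrable_const (c := L ^ (-α)) (μ := volume)) (hc.intervalIntegrable 0 L)
      (fun x hx => by
        rw [← hgL]
        exact gFun_le_gFun hα.le (by rw [abs_of_nonneg hx.1, abs_of_pos hL0]; exact hx.2))
    simpa using this
  have h2 : ∫ x in L..2 * L, gFun α x ≤ L * L ^ (-α) := by
    have := intervalIntegral.integral_mono_on (by linarith) (hc.intervalIntegrable L (2 * L))
      (intervalIntegrable_const (c := L ^ (-α)) (μ := volume))
      (fun x hx => by
        rw [← hgL]
        exact gFun_le_gFun hα.le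
          (by rw [abs_of_pos hL0, abs_of_pos (hL0.trans_le hx.1)]; exact hx.1))
    rw [intervalIntegral.integral_const, smul_eq_mul] at this
    linarith
  have h3 : L * (2 * L) ^ (-α) ≤ ∫ x in L..2 * L, gFun α x := by
    have := intervalIntegral.integral_mono_on (by linarith)
      (intervalIntegrable_const (c := (2 * L) ^ (-α)) (μ := volume))
      (hc.intervalIntegrable L (2 * L))
      (fun x hx => by
        rw [← hg2L]
        exact gFun_le_gFun hα.le (by
          rw [abs_of_pos (hL0.trans_le hx.1), abs_of_pos (by linarith)]; exact hx.2))
    rw [intervalIntegral.integral_const, smul_eq_mul] at this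
    linarith
  have h4 : ∫ x in (0 : ℝ)..L, gFun α x ≤ L * L ^ (-α) / (1 - α) := by
    have := intervalIntegral.integral_mono_on_of_le_Ioo hL0.le (hc.intervalIntegrable 0 L)
      (intervalIntegral.intervalIntegrable_rpow' (r := -α) (by linarith))
      (fun x hx => by
        rw [gFun_eq_max]
        refine Real.rpow_le_rpow_of_nonpos hx.1 ?_ (by linarith)
        exact (le_abs_self x).trans (le_max_right _ _))
    rw [integral_rpow (Or.inl (by linarith)), Real.zero_rpow (by linarith), sub_zero,
      Real.rpow_add hL0, Real.rpow_one] at this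
    rw [show -α + 1 = 1 - α by ring] at this
    rwa [mul_comm L]
  set P := L ^ (-α) with hP
  have hP0 : 0 < P := Real.rpow_pos_of_pos hL0 _
  have hQ0 : 0 < (2 * L) ^ (-α) := Real.rpow_pos_of_pos (by linarith) _
  have h5 : 1 / (1 - α) ≤ 1 + 2 * α := by
    rw [div_le_iff₀ (by linarith)]; nlinarith
  have h6 : P - (2 * L) ^ (-α) ≤ α * P := by
    have := rpow_neg_sub_rpow_neg_le hα.le hL0 (show L ≤ 2 * L by linarith)
    rwa [show (2 * L - L) / L = 1 by field_simp; ring, mul_one] at this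
  have h7 : L * P / (1 - α) ≤ L * P * (1 + 2 * α) := by
    rw [div_eq_mul_one_div]
    exact mul_le_mul_of_nonneg_left h5 (by positivity)
  have h8 : P ≤ 2 * (2 * L) ^ (-α) := by nlinarith
  rw [abs_of_nonneg (by linarith)]
  have h9 : L * (P - (2 * L) ^ (-α)) ≤ L * (α * P) := mul_le_mul_of_nonneg_left h6 hL0.le
  have h10 : 3 * α * L * P ≤ 3 * α * L * (2 * (2 * L) ^ (-α)) :=
    mul_le_mul_of_nonneg_left h8 (by positivity)
  linarith

lemma two_zpow_rpow_sq (α : ℝ) (n : ℕ) :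
    (((2 : ℝ) ^ (n : ℤ)) ^ (-α)) ^ 2 = ((4 : ℝ) ^ (-α)) ^ n := by
  rw [zpow_natCast, ← Real.rpow_natCast, ← Real.rpow_natCast, ← Real.rpow_natCast,
    ← Real.rpow_mul (by norm_num), ← Real.rpow_mul (by norm_num), ← Real.rpow_mul (by norm_num),
    show (4 : ℝ) = 2 ^ (2 : ℝ) by norm_num, ← Real.rpow_mul (by norm_num)]
  congr 1
  push_cast
  ring

lemma sq_integral_gFun_mul_haarW_le {α : ℝ} (hα : 0 < α) (hα2 : α ≤ 1 / 2) (l j : ℤ) :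
    (∫ y, gFun α y * haarW (dyadL l j) (dyadR l j) y) ^ 2 ≤
      9 * α ^ 2 * ((4 : ℝ) ^ (-α)) ^ l.natAbs * 2 ^ l := by
  have hc := continuous_gFun α
  have hlt := dyadL_lt_dyadR l j
  have hd := dyadR_sub_dyadL l j
  have hpos : (0 : ℝ) < 2 ^ l := by positivity
  rcases le_or_gt l 0 with hl | hl
  · obtain ⟨n, rfl⟩ : ∃ n : ℕ, l = -n := ⟨l.natAbs, by omega⟩
    have h := sq_integral_mul_haarW_le_of_abs_sub_le hc (M := α * 2 ^ (-(n : ℤ))) hlt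
      (fun x _ => (abs_gFun_sub_gFun_le hα.le).trans
        (mul_le_mul_of_nonneg_left (by
          rw [hd, add_sub_cancel_left, abs_of_nonneg (by positivity)]; linarith) hα.le))
    rw [hd] at h
    refine h.trans (mul_le_mul_of_nonneg_right ?_ hpos.le)
    have h4 : (1 / 4 : ℝ) ≤ 4 ^ (-α) := by
      rw [show (1 / 4 : ℝ) = 4 ^ (-1 : ℝ) by rw [Real.rpow_neg_one]; norm_num]
      exact Real.rpow_le_rpow_of_exponent_le (by norm_num) (by linarith)
    have h5 : ((2 : ℝ) ^ (-(n : ℤ))) ^ 2 = (1 / 4) ^ n := by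
      rw [zpow_neg, zpow_natCast, inv_pow, ← pow_mul, mul_comm, pow_mul, one_div, inv_pow]
      norm_num
    have h6 : (1 / 4 : ℝ) ^ n ≤ (4 ^ (-α)) ^ n := pow_le_pow_left₀ (by norm_num) h4 n
    rw [mul_pow, h5, Int.natAbs_neg, Int.natAbs_natCast]
    have h7 : (0 : ℝ) ≤ (4 ^ (-α)) ^ n := by positivity
    nlinarith [mul_le_mul_of_nonneg_left h6 (sq_nonneg α), mul_nonneg (sq_nonneg α) h7]
  · obtain ⟨n, rfl⟩ : ∃ n : ℕ, l = n := ⟨l.natAbs, by omega⟩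
    set T : ℝ := 2 ^ (n : ℤ) with hT
    have hT2 : 2 ≤ T := by
      have := zpow_le_zpow_right₀ (one_le_two (α := ℝ)) (show (1 : ℤ) ≤ n by omega)
      simpa [hT] using this
    have hTα : 0 ≤ T ^ (-α) := by positivity
    have hM : (3 * α * T ^ (-α)) ^ 2 = 9 * α ^ 2 * ((4 : ℝ) ^ (-α)) ^ n := by
      rw [← two_zpow_rpow_sq]; ring
    rw [Int.natAbs_natCast, ← hM]
    have key : ∀ a b : ℝ, b - a = T → (T ≤ a ∨ b ≤ -T) →
        (∫ y, gFun α y * haarW a b y) ^ 2 ≤ (3 * α * T ^ (-α)) ^ 2 * (b - a) := by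
      intro a b hab hfar
      refine sq_integral_mul_haarW_le_of_abs_sub_le hc (by linarith) fun x hx => ?_
      have hx1 := hx.1
      have hx2 := hx.2
      refine (abs_gFun_sub_gFun_le_of_le hα.le (t := T) (by linarith) ?_ ?_ ?_).trans ?_
      · rcases hfar with h | h
        · exact (by linarith : T ≤ x).trans (le_abs_self x)
        · exact (by linarith : T ≤ -x).trans (neg_le_abs x)
      · rcases hfar with h | h
        · exact (by linarith : T ≤ x + (b - a) / 2).trans (le_abs_self _)
        · exact (by linarith : T ≤ -(x + (b - a) / 2)).trans (neg_le_abs _)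
      · rw [add_sub_cancel_left, abs_of_nonneg (by linarith)]; linarith
      · nlinarith [mul_nonneg hα.le hTα]
    have hmid := abs_integral_gFun_sub_le hα hα2 (L := T / 2) (by linarith)
    rw [show 2 * (T / 2) = T by ring] at hmid
    suffices h : (∫ y, gFun α y * haarW (dyadL n j) (dyadR n j) y) ^ 2 ≤
        (3 * α * T ^ (-α)) ^ 2 * (dyadR n j - dyadL n j) by rwa [hd] at h
    rcases lt_trichotomy j 0 with hj | hj | hj
    · rcases eq_or_ne j (-1) with hj1 | hj1
      · refine sq_integral_mul_haarW_le hc hlt ?_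
        have e1 : dyadL n j = -T := by simp [dyadL, hj1, hT]
        have e2 : dyadR n j = 0 := by simp [dyadR, hj1]
        rw [e1, e2, show (-T + 0) / 2 = -(T / 2) by ring, sub_neg_eq_add, zero_add]
        have r : ∀ a b : ℝ, ∫ x in -b..-a, gFun α x = ∫ x in a..b, gFun α x := fun a b => by
          rw [← intervalIntegral.integral_comp_neg]
          simp_rw [gFun_neg]
        rw [r, abs_sub_comm, ← neg_zero, r]
        exact hmid
      · refine key _ _ hd (Or.inr ?_)
        have : (j : ℝ) + 1 ≤ -1 := by exact_mod_cast (by omega : j + 1 ≤ -1)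
        unfold dyadR
        nlinarith
    · refine sq_integral_mul_haarW_le hc hlt ?_
      have e1 : dyadL n j = 0 := by simp [dyadL, hj]
      have e2 : dyadR n j = T := by simp [dyadR, hj, hT]
      rw [e1, e2, zero_add, sub_zero]
      exact hmid
    · refine key _ _ hd (Or.inl ?_)
      have : (1 : ℝ) ≤ j := by exact_mod_cast hj
      unfold dyadL
      nlinarith

lemma sq_integral_lipschitz_mul_haarW_le {f : ℝ → ℝ} {K : ℝ≥0} (hK : LipschitzWith K f)
    (hsupp : Function.support f ⊆ Icc 1 2) (hint : (∫ x : ℝ, f x) = 0) (k j : ℤ) :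
    (∫ x, f x * haarW (dyadL k j) (dyadR k j) x) ^ 2 ≤
      16 * (K : ℝ) ^ 2 * (1 / 4) ^ k.natAbs * 2 ^ k := by
  have hlt := dyadL_lt_dyadR k j
  have hd := dyadR_sub_dyadL k j
  have hpos : (0 : ℝ) < 2 ^ k := by positivity
  have hz : ∀ x, x < 1 ∨ 2 < x → f x = 0 := fun x hx => by
    by_contra h
    have := hsupp h
    rcases hx with hx | hx <;> linarith [this.1, this.2]
  rcases le_or_gt k 1 with hk | hk
  · have h := sq_integral_mul_haarW_le_of_abs_sub_le hK.continuous (M := K * 2 ^ k) hlt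
      (fun x _ => by
        have := hK.dist_le_mul x (x + (dyadR k j - dyadL k j) / 2)
        rw [Real.dist_eq, Real.dist_eq, hd, sub_add_cancel_left, abs_neg,
          abs_of_nonneg (by positivity : (0 : ℝ) ≤ 2 ^ k / 2)] at this
        rw [hd]
        refine this.trans (mul_le_mul_of_nonneg_left (by linarith) K.coe_nonneg))
    rw [hd] at h
    refine h.trans (mul_le_mul_of_nonneg_right ?_ hpos.le)
    have h5 : ((2 : ℝ) ^ k) ^ 2 ≤ 16 * (1 / 4) ^ k.natAbs := by
      rcases le_or_gt k 0 with h0 | h0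
      · obtain ⟨n, rfl⟩ : ∃ n : ℕ, k = -n := ⟨k.natAbs, by omega⟩
        have h5 : ((2 : ℝ) ^ (-(n : ℤ))) ^ 2 = (1 / 4) ^ n := by
          rw [zpow_neg, zpow_natCast, inv_pow, ← pow_mul, mul_comm, pow_mul, one_div, inv_pow]
          norm_num
        rw [h5, Int.natAbs_neg, Int.natAbs_natCast]
        have : (0 : ℝ) ≤ (1 / 4) ^ n := by positivity
        linarith
      · obtain rfl : k = 1 := by omega
        norm_num
    rw [mul_pow]
    nlinarith [mul_le_mul_of_nonneg_left h5 (sq_nonneg (K : ℝ))]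
  · have h0 : (∫ x, f x * haarW (dyadL k j) (dyadR k j) x) = 0 := by
      have hT : (4 : ℝ) ≤ 2 ^ k := by
        have := zpow_le_zpow_right₀ (one_le_two (α := ℝ)) (show (2 : ℤ) ≤ k by omega)
        norm_num at this ⊢
        exact this
      rcases eq_or_ne j 0 with rfl | hj
      · rw [integral_mul_haarW hK.continuous hlt.le]
        have e1 : dyadL k 0 = 0 := by simp [dyadL]
        have e2 : dyadR k 0 = 2 ^ k := by simp [dyadR]
        rw [e1, e2, zero_add,
          intervalIntegral.integral_eq_integral_of_support_subset (hsupp.trans (fun x hx =>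
            ⟨by linarith [hx.1], by linarith [hx.2]⟩)), hint,
          intervalIntegral.integral_of_le (by linarith : (2 : ℝ) ^ k / 2 ≤ 2 ^ k),
          setIntegral_eq_zero_of_forall_eq_zero (fun x hx => hz x (Or.inr (by linarith [hx.1])))]
        simp
      · have hv : ∀ x, f x * haarW (dyadL k j) (dyadR k j) x = 0 := by
          intro x
          by_cases hx : x ∈ Ico (dyadL k j) (dyadR k j)
          · rw [hz x, zero_mul]
            rcases lt_or_gt_of_ne hj with hj | hj
            · left
              have : (j : ℝ) + 1 ≤ 0 := by exact_mod_cast hj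
              have h1 := hx.2
              unfold dyadR at h1
              nlinarith
            · right
              have : (1 : ℝ) ≤ j := by exact_mod_cast hj
              have h1 := hx.1
              unfold dyadL at h1
              nlinarith
          · have h1 : x ∉ Ico (dyadL k j) ((dyadL k j + dyadR k j) / 2) := fun h =>
              hx ⟨h.1, by linarith [h.2]⟩
            have h2 : x ∉ Ico ((dyadL k j + dyadR k j) / 2) (dyadR k j) := fun h =>
              hx ⟨by linarith [h.1], h.2⟩
            simp [haarW, h1, h2]
        simp [hv]
    rw [h0, zero_pow two_ne_zero]
    positivity

lemma volume_dyadRect (q : (ℤ × ℤ) × ℤ × ℤ) :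
    volume (dyadRect q) = ENNReal.ofReal (2 ^ q.1.1 * 2 ^ q.2.1) := by
  rw [dyadRect, Measure.volume_eq_prod, Measure.prod_prod, Real.volume_Ico, Real.volume_Ico,
    dyadR_sub_dyadL, dyadR_sub_dyadL, ENNReal.ofReal_mul (by positivity)]

lemma eq_of_mem_dyadic {k i j : ℤ} {x : ℝ} (hi : x ∈ Ico (dyadL k i) (dyadR k i))
    (hj : x ∈ Ico (dyadL k j) (dyadR k j)) : i = j := by
  have hpos : (0 : ℝ) < 2 ^ k := by positivity
  have aux : ∀ i j : ℤ, dyadL k i < dyadR k j → i ≤ j := fun i j h => by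
    have : (i : ℝ) < j + 1 := lt_of_mul_lt_mul_left h hpos.le
    have : i < j + 1 := by exact_mod_cast this
    omega
  exact le_antisymm (aux _ _ (hi.1.trans_lt hj.2)) (aux _ _ (hj.1.trans_lt hi.2))

/-- Dyadic rectangles of a fixed shape inside `Ω` have total area at most `|Ω|`. -/
lemma tsum_volume_dyadRect_le (Ω : Set (ℝ × ℝ)) (s : ℤ × ℤ) :
    ∑' t : ℤ × ℤ, {q | dyadRect q ⊆ Ω}.indicator (fun q => volume (dyadRect q))
      ((s.1, t.1), (s.2, t.2)) ≤ volume Ω := by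
  have hm : ∀ q, MeasurableSet (dyadRect q) := fun q => measurableSet_Ico.prod measurableSet_Ico
  set A : ℤ × ℤ → Set (ℝ × ℝ) := fun t =>
    {z | z ∈ dyadRect ((s.1, t.1), (s.2, t.2)) ∧ dyadRect ((s.1, t.1), (s.2, t.2)) ⊆ Ω} with hA
  have h1 : ∀ t, {q | dyadRect q ⊆ Ω}.indicator (fun q => volume (dyadRect q))
      ((s.1, t.1), (s.2, t.2)) = volume (A t) := by
    intro t
    by_cases h : dyadRect ((s.1, t.1), (s.2, t.2)) ⊆ Ω <;> simp [hA, indicator, h]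
  have hAm : ∀ t, MeasurableSet (A t) := by
    intro t
    by_cases h : dyadRect ((s.1, t.1), (s.2, t.2)) ⊆ Ω <;> simp [hA, h, hm]
  have hd : Pairwise (Function.onFun Disjoint A) := by
    intro t u htu
    refine disjoint_left.2 fun z hz hz' => htu ?_
    exact Prod.ext (eq_of_mem_dyadic hz.1.1 hz'.1.1) (eq_of_mem_dyadic hz.1.2 hz'.1.2)
  simp_rw [h1]
  rw [← measure_iUnion hd hAm]
  exact measure_mono (iUnion_subset fun t z hz => hz.2 hz.1)

lemma tsum_ofReal_pow_natAbs_le {r : ℝ} (h0 : 0 ≤ r) (h1 : r < 1) :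
    ∑' k : ℤ, ENNReal.ofReal (r ^ k.natAbs) ≤ ENNReal.ofReal (2 / (1 - r)) := by
  have hg : ∑' n : ℕ, ENNReal.ofReal (r ^ n) = ENNReal.ofReal (1 / (1 - r)) := by
    rw [← ENNReal.ofReal_tsum_of_nonneg (fun n => by positivity)
      (summable_geometric_of_lt_one h0 h1), tsum_geometric_of_lt_one h0 h1, one_div]
  have hs := (HasSum.of_nat_of_neg_add_one (f := fun k : ℤ => ENNReal.ofReal (r ^ k.natAbs))
    ENNReal.summable.hasSum ENNReal.summable.hasSum).tsum_eq
  rw [hs, show 2 / (1 - r) = 1 / (1 - r) + 1 / (1 - r) by ring,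
    ENNReal.ofReal_add (by have := sub_pos.2 h1; positivity) (by have := sub_pos.2 h1; positivity),
    ← hg]
  refine add_le_add (by simp) (ENNReal.tsum_le_tsum fun n => ENNReal.ofReal_le_ofReal ?_)
  refine pow_le_pow_of_le_one h0 h1.le ?_
  omega

/-- A sequence over dyadic rectangles bounded by a product of scale weights times the area
satisfies the biparameter Carleson packing condition. -/
lemma tsum_dyadRect_subset_le (Ω : Set (ℝ × ℝ)) (c : (ℤ × ℤ) × ℤ × ℤ → ℝ≥0∞) (w v : ℤ → ℝ≥0∞)
    (hc : ∀ q, c q ≤ w q.1.1 * v q.2.1 * volume (dyadRect q)) :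
    ∑' r : {q : (ℤ × ℤ) × ℤ × ℤ // dyadRect q ⊆ Ω}, c r.1 ≤
      (∑' k, w k) * (∑' l, v l) * volume Ω := by
  have e1 : ∑' r : {q : (ℤ × ℤ) × ℤ × ℤ // dyadRect q ⊆ Ω}, c r.1 =
      ∑' q, {q | dyadRect q ⊆ Ω}.indicator c q := tsum_subtype {q | dyadRect q ⊆ Ω} c
  rw [e1, ← (Equiv.prodProdProdComm ℤ ℤ ℤ ℤ).tsum_eq, ENNReal.tsum_prod',
    ← ENNReal.tsum_mul_right]
  calc _ ≤ ∑' s : ℤ × ℤ, w s.1 * v s.2 * volume Ω := by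
        refine ENNReal.tsum_le_tsum fun s => ?_
        refine le_trans ?_ (mul_le_mul_right (tsum_volume_dyadRect_le Ω s) _)
        rw [← ENNReal.tsum_mul_left]
        refine ENNReal.tsum_le_tsum fun t => ?_
        by_cases h : dyadRect ((s.1, t.1), (s.2, t.2)) ⊆ Ω
        · simpa [indicator, h] using hc ((s.1, t.1), (s.2, t.2))
        · simp [indicator, h]
    _ = _ := by
        rw [ENNReal.tsum_prod']
        simp_rw [ENNReal.tsum_mul_right, ENNReal.tsum_mul_left]
        simp_rw [ENNReal.tsum_mul_right]

lemma four_rpow_neg_le {α : ℝ} (hα : 0 < α) (hα2 : α ≤ 1 / 2) :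
    (4 : ℝ) ^ (-α) ≤ 1 - α / 2 := by
  have h4 : 1 + α ≤ (4 : ℝ) ^ α := by
    have hl : 1 ≤ Real.log 4 := by
      rw [Real.le_log_iff_exp_le (by norm_num)]
      linarith [Real.exp_one_lt_d9]
    rw [Real.rpow_def_of_pos (by norm_num)]
    nlinarith [Real.add_one_le_exp (Real.log 4 * α)]
  rw [Real.rpow_neg (by norm_num)]
  refine (inv_anti₀ (by linarith) h4).trans ?_
  rw [inv_le_iff_one_le_mul₀ (by linarith)]
  nlinarith

/-- Carleson packing bound for `f ⊗ g_α` with linear decay in `α`. -/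
lemma tsum_sq_dyadCoef_le {f : ℝ → ℝ} {K : ℝ≥0} (hK : LipschitzWith K f)
    (hsupp : Function.support f ⊆ Icc 1 2) (hint : (∫ x : ℝ, f x) = 0) {α : ℝ} (hα : 0 < α)
    (hα2 : α ≤ 1 / 2) (Ω : Set (ℝ × ℝ)) :
    ∑' r : {q : (ℤ × ℤ) × ℤ × ℤ // dyadRect q ⊆ Ω},
        ENNReal.ofReal ((dyadCoef (fun q : ℝ × ℝ => f q.1 * gFun α q.2) r.1) ^ 2) ≤
      ENNReal.ofReal (1600 * (K : ℝ) ^ 2 * α) * volume Ω := by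
  have hr := four_rpow_neg_le hα hα2
  have hr0 : (0 : ℝ) < 4 ^ (-α) := by positivity
  have hw := mul_le_mul_right
    (tsum_ofReal_pow_natAbs_le (r := 1 / 4) (by norm_num) (by norm_num))
    (ENNReal.ofReal (16 * (K : ℝ) ^ 2))
  have hv := mul_le_mul_right (tsum_ofReal_pow_natAbs_le hr0.le (by linarith : (4 : ℝ) ^ (-α) < 1))
    (ENNReal.ofReal (9 * α ^ 2))
  rw [← ENNReal.tsum_mul_left, ← ENNReal.ofReal_mul (by positivity)] at hw hv
  refine (tsum_dyadRect_subset_le Ω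
    (fun q => ENNReal.ofReal ((dyadCoef (fun z : ℝ × ℝ => f z.1 * gFun α z.2) q) ^ 2)) _ _
    fun q => ?_).trans (mul_le_mul_left ((mul_le_mul' hw hv).trans ?_) _)
  · rw [dyadCoef_mul, volume_dyadRect, ← ENNReal.ofReal_mul (by positivity),
      ← ENNReal.ofReal_mul (by positivity), ← ENNReal.ofReal_mul (by positivity),
      ← ENNReal.ofReal_mul (by positivity), mul_pow]
    refine ENNReal.ofReal_le_ofReal ((mul_le_mul
      (sq_integral_lipschitz_mul_haarW_le hK hsupp hint q.1.1 q.1.2)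
      (sq_integral_gFun_mul_haarW_le hα hα2 q.2.1 q.2.2) (sq_nonneg _) (by positivity)).trans_eq ?_)
    ring
  · rw [← ENNReal.ofReal_mul (by positivity)]
    refine ENNReal.ofReal_le_ofReal ?_
    have h1 : 9 * α ^ 2 * (2 / (1 - 4 ^ (-α))) ≤ 36 * α := by
      rw [← mul_div_assoc, div_le_iff₀ (by linarith)]
      nlinarith
    refine (mul_le_mul_of_nonneg_left h1 (by positivity)).trans ?_
    nlinarith [mul_nonneg (sq_nonneg (K : ℝ)) hα.le]

/-- Lemma 3.3 of the paper (Property B), dyadic form: the dyadic biparameter BMO norm of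
`F = f ⊗ g_{2/p}` decays like `p^{-1/4}`. -/
theorem counterexample_bmo_decay (f : ℝ → ℝ) (hlip : ∃ K : ℝ≥0, LipschitzWith K f)
    (hsupp : Function.support f ⊆ Icc 1 2) (hint : (∫ x : ℝ, f x) = 0) :
    ∃ C : ℝ, 0 < C ∧ ∀ p : ℝ, 4 < p →
      ∀ Ω : Set (ℝ × ℝ), IsOpen Ω → 0 < volume Ω → volume Ω < ⊤ →
        ((∑' r : {q : (ℤ × ℤ) × ℤ × ℤ // dyadRect q ⊆ Ω},
            ENNReal.ofReal ((dyadCoef (fun q : ℝ × ℝ => f q.1 * gFun (2/p) q.2) r.1) ^ 2)) /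
          volume Ω) ^ (1/2 : ℝ) ≤ ENNReal.ofReal (C * p ^ (-(1:ℝ)/4)) := by
  obtain ⟨K, hK⟩ := hlip
  refine ⟨Real.sqrt (3200 * (K : ℝ) ^ 2) + 1, by positivity, fun p hp Ω _ h0 htop => ?_⟩
  have hp0 : 0 < p := by linarith
  have hS := tsum_sq_dyadCoef_le hK hsupp hint (α := 2 / p) (by positivity)
    (by rw [div_le_div_iff₀ hp0 two_pos]; linarith) Ω
  have hdiv := ENNReal.div_le_of_le_mul hS
  refine (ENNReal.rpow_le_rpow hdiv (by norm_num)).trans ?_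
  rw [ENNReal.ofReal_rpow_of_nonneg (by positivity) (by norm_num)]
  refine ENNReal.ofReal_le_ofReal ?_
  rw [show 1600 * (K : ℝ) ^ 2 * (2 / p) = 3200 * (K : ℝ) ^ 2 * p⁻¹ by ring,
    Real.mul_rpow (by positivity) (by positivity), ← Real.sqrt_eq_rpow]
  refine mul_le_mul (by linarith) ?_ (by positivity) (by positivity)
  rw [← Real.rpow_neg_one, ← Real.rpow_mul hp0.le]
  exact Real.rpow_le_rpow_of_exponent_le (by linarith) (by norm_num)
end
end

section
/- Let Ω ⊆ ℝ² be open with finite Lebesgue measure, let ε ∈ (0,1), and define Ω̃ := {(x,y) : MM(𝟙_Ω)(x,y) > ε} and Ω̃̃ := {(x,y) : MM(𝟙_{Ω̃})(x,y) > ε}. Let K₀ be a bounded axis-parallel rectangle of positive measure with K₀ ⊆ Ω, and let l ∈ ℕ. If 2^{l+1}K₀ is not contained in Ω̃̃, then 2^{−2l} < 16·ε. -/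
open MeasureTheory Set
open scoped ENNReal

noncomputable section

/-- The strong (biparameter) maximal function: supremum of averages of `|f|` over
bounded open axis-parallel rectangles containing the point. -/
def MMax (f : ℝ × ℝ → ℝ) (x : ℝ × ℝ) : ℝ :=
  sSup {m : ℝ | ∃ a b c d : ℝ, a < b ∧ c < d ∧ x ∈ Ioo a b ×ˢ Ioo c d ∧
    m = ((b - a) * (d - c))⁻¹ * ∫ q in Ioo a b ×ˢ Ioo c d, |f q|}

/-- The `ε`-enlargement `Ω̃ = {MM(𝟙_Ω) > ε}` of a set `Ω ⊆ ℝ²`. -/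
def enlarge (Ω : Set (ℝ × ℝ)) (ε : ℝ) : Set (ℝ × ℝ) :=
  {z : ℝ × ℝ | ε < MMax (Ω.indicator 1) z}

theorem volume_real_Ioo_prod_Ioo {a b c d : ℝ} (hab : a ≤ b) (hcd : c ≤ d) :
    volume.real (Ioo a b ×ˢ Ioo c d) = (b - a) * (d - c) := by
  rw [Measure.volume_eq_prod, measureReal_prod_prod, Real.volume_real_Ioo_of_le hab,
    Real.volume_real_Ioo_of_le hcd]

theorem volume_Ioo_prod_Ioo_lt_top (a b c d : ℝ) :
    volume (Ioo a b ×ˢ Ioo c d) < ⊤ := by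
  rw [Measure.volume_eq_prod, Measure.prod_prod, Real.volume_Ioo, Real.volume_Ioo]
  exact ENNReal.mul_lt_top ENNReal.ofReal_lt_top ENNReal.ofReal_lt_top

/-- Averages of an indicator function are bounded by one, measurable or not, so a point of a
rectangle over which the indicator has average larger than `ε` lies in the `ε`-enlargement. -/
theorem mem_enlarge_of_lt_setIntegral {A : Set (ℝ × ℝ)} {ε a b c d : ℝ} {z : ℝ × ℝ}
    (hz : z ∈ Ioo a b ×ˢ Ioo c d)
    (h : ε * ((b - a) * (d - c)) < ∫ q in Ioo a b ×ˢ Ioo c d, |A.indicator (1 : ℝ × ℝ → ℝ) q|) :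
    z ∈ enlarge A ε := by
  have hab : a < b := hz.1.1.trans hz.1.2
  have hcd : c < d := hz.2.1.trans hz.2.2
  have hpos : 0 < (b - a) * (d - c) := mul_pos (sub_pos.2 hab) (sub_pos.2 hcd)
  have havg : ε < ((b - a) * (d - c))⁻¹ *
      ∫ q in Ioo a b ×ˢ Ioo c d, |A.indicator (1 : ℝ × ℝ → ℝ) q| := by
    rwa [inv_mul_eq_div, lt_div_iff₀ hpos]
  refine havg.trans_le (le_csSup ⟨1, ?_⟩ ⟨a, b, c, d, hab, hcd, hz, rfl⟩)
  · rintro m ⟨a', b', c', d', hab', hcd', -, rfl⟩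
    have hpos' : 0 < (b' - a') * (d' - c') := mul_pos (sub_pos.2 hab') (sub_pos.2 hcd')
    rw [inv_mul_eq_div, div_le_one hpos']
    have key := norm_setIntegral_le_of_norm_le_const (C := 1)
      (f := fun q => |A.indicator (1 : ℝ × ℝ → ℝ) q|) (volume_Ioo_prod_Ioo_lt_top a' b' c' d')
      (fun q _ => by
        by_cases hq : q ∈ A <;> simp [hq])
    rw [volume_real_Ioo_prod_Ioo hab'.le hcd'.le, one_mul] at key
    exact (le_abs_self _).trans key

/-- A point of a rectangle contained in `A` belongs to every enlargement of `A`. -/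
theorem mem_enlarge_of_Ioo_prod_subset {A : Set (ℝ × ℝ)} {ε a b c d : ℝ} {z : ℝ × ℝ}
    (hε : ε < 1) (hz : z ∈ Ioo a b ×ˢ Ioo c d) (hA : Ioo a b ×ˢ Ioo c d ⊆ A) :
    z ∈ enlarge A ε := by
  have hab : a < b := hz.1.1.trans hz.1.2
  have hcd : c < d := hz.2.1.trans hz.2.2
  have hpos : 0 < (b - a) * (d - c) := mul_pos (sub_pos.2 hab) (sub_pos.2 hcd)
  refine mem_enlarge_of_lt_setIntegral hz ?_
  have heq : ∫ q in Ioo a b ×ˢ Ioo c d, |A.indicator (1 : ℝ × ℝ → ℝ) q|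
      = ∫ _ in Ioo a b ×ˢ Ioo c d, (1 : ℝ) :=
    setIntegral_congr_fun (measurableSet_Ioo.prod measurableSet_Ioo)
      (fun q hq => by simp [hA hq])
  rw [heq, setIntegral_const, volume_real_Ioo_prod_Ioo hab.le hcd.le, smul_eq_mul, mul_one]
  nlinarith

/-- A rectangle containing a subset `K` of `A` of relative measure larger than `ε` lies in the
`ε`-enlargement of `A`. -/
theorem mem_enlarge_of_lt_volume {A K : Set (ℝ × ℝ)} {ε a b c d : ℝ} {z : ℝ × ℝ}
    (hA : MeasurableSet A) (hKA : K ⊆ A) (hK : K ⊆ Ioo a b ×ˢ Ioo c d)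
    (hz : z ∈ Ioo a b ×ˢ Ioo c d) (h : ε * ((b - a) * (d - c)) < volume.real K) :
    z ∈ enlarge A ε := by
  refine mem_enlarge_of_lt_setIntegral hz (h.trans_le ?_)
  have heq : (fun q => |A.indicator (1 : ℝ × ℝ → ℝ) q|) = A.indicator 1 := by
    ext q
    by_cases hq : q ∈ A <;> simp [hq]
  rw [heq, integral_indicator_one hA, measureReal_restrict_apply hA]
  exact measureReal_mono (subset_inter hKA hK)
    ((measure_mono inter_subset_right).trans_lt (volume_Ioo_prod_Ioo_lt_top a b c d)).ne

/-- Lemma 4.2 of the paper: if `K₀ ⊆ Ω` is a rectangle (center `(x₀,y₀)`, half-sides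
`u,v`) whose `2^{l+1}`-fold dilate escapes the doubly enlarged set `Ω̃̃`, then
`2^{-2l} < 16·ε`. -/
theorem escape_level_bound (Ω : Set (ℝ × ℝ)) (hΩo : IsOpen Ω) (hΩv : volume Ω < ⊤)
    (ε : ℝ) (hε : ε ∈ Ioo (0:ℝ) 1)
    (x₀ y₀ u v : ℝ) (hu : 0 < u) (hv : 0 < v)
    (hK : Ico (x₀ - u) (x₀ + u) ×ˢ Ico (y₀ - v) (y₀ + v) ⊆ Ω)
    (l : ℕ)
    (hesc : ¬ (Ico (x₀ - 2^(l+1) * u) (x₀ + 2^(l+1) * u) ×ˢ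
        Ico (y₀ - 2^(l+1) * v) (y₀ + 2^(l+1) * v) ⊆ enlarge (enlarge Ω ε) ε)) :
    ((2:ℝ) ^ (2 * l))⁻¹ < 16 * ε := by
  by_contra! hle
  refine hesc fun z hz => ?_
  set L : ℝ := 2 ^ (l + 1) with hL
  have hL1 : 1 ≤ L := one_le_pow₀ one_le_two
  have hsq : L ^ 2 = 4 * 2 ^ (2 * l) := by rw [hL]; ring
  have hεL : ε * (4 * L ^ 2) ≤ 1 := by
    have hp : (0 : ℝ) < 2 ^ (2 * l) := by positivity
    rw [← one_div, le_div_iff₀ hp] at hle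
    rw [hsq]
    linarith
  have hLu : u ≤ L * u := le_mul_of_one_le_left hu.le hL1
  have hLv : v ≤ L * v := le_mul_of_one_le_left hv.le hL1
  obtain ⟨⟨hz1, hz2⟩, hz3, hz4⟩ := hz
  have hzR : z ∈ Ioo (x₀ - 3 / 2 * (L * u)) (x₀ + 3 / 2 * (L * u)) ×ˢ
      Ioo (y₀ - 3 / 2 * (L * v)) (y₀ + 3 / 2 * (L * v)) :=
    ⟨⟨by linarith, by linarith⟩, by linarith, by linarith⟩
  refine mem_enlarge_of_Ioo_prod_subset hε.2 hzR fun w hw => ?_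
  refine mem_enlarge_of_lt_volume hΩo.measurableSet
    ((prod_mono Ioo_subset_Ico_self Ioo_subset_Ico_self).trans hK)
    (prod_mono (Ioo_subset_Ioo (by linarith) (by linarith))
      (Ioo_subset_Ioo (by linarith) (by linarith))) hw ?_
  rw [volume_real_Ioo_prod_Ioo (by linarith) (by linarith)]
  have huv : 0 < u * v := mul_pos hu hv
  have hlt : ε * (9 / 4 * L ^ 2) < 1 := by
    have : 0 < ε * L ^ 2 := mul_pos hε.1 (by positivity)
    linarith
  nlinarith [mul_lt_mul_of_pos_right hlt huv]
end
end

section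
/- For every ν > 0 there exists a constant C_ν such that the following holds. Let ε ∈ (0, 1/4], let Ω ⊆ ℝ² be open with 0 < |Ω| < ∞, define Ω̃ := {MM(𝟙_Ω) > ε} and Ω̃̃ := {MM(𝟙_{Ω̃}) > ε}, call a dyadic rectangle K ⊆ Ω maximal if there is no dyadic rectangle K′ with K ⊊ K′ ⊆ Ω, and for an integer l ≥ 1 let 𝒦_l be the set of maximal dyadic rectangles K ⊆ Ω with 2^l K ⊆ Ω̃̃ and 2^{l+1}K ⊄ Ω̃̃. Then for every integer l ≥ 1 with 2^{−2l} ≤ 16·ε: Σ_{K ∈ 𝒦_l} |K| ≤ C_ν · (√ε · 2^l)^ν · |Ω|. -/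
open MeasureTheory Set
open scoped ENNReal

noncomputable section

/-- The concentric dilate by a factor `t > 0` of the dyadic rectangle indexed by `q`. -/
def dyadRectDil (t : ℝ) (q : (ℤ × ℤ) × ℤ × ℤ) : Set (ℝ × ℝ) :=
  Ico ((2:ℝ) ^ q.1.1 * ((q.1.2 : ℝ) + 1/2) - t * (2:ℝ) ^ q.1.1 / 2)
      ((2:ℝ) ^ q.1.1 * ((q.1.2 : ℝ) + 1/2) + t * (2:ℝ) ^ q.1.1 / 2) ×ˢ
  Ico ((2:ℝ) ^ q.2.1 * ((q.2.2 : ℝ) + 1/2) - t * (2:ℝ) ^ q.2.1 / 2)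
      ((2:ℝ) ^ q.2.1 * ((q.2.2 : ℝ) + 1/2) + t * (2:ℝ) ^ q.2.1 / 2)

/-- A dyadic rectangle is maximal in `Ω` if it is contained in `Ω` and no strictly
larger dyadic rectangle is contained in `Ω`. -/
def IsMaximalIn (Ω : Set (ℝ × ℝ)) (q : (ℤ × ℤ) × ℤ × ℤ) : Prop :=
  dyadRect q ⊆ Ω ∧ ¬ ∃ q' : (ℤ × ℤ) × ℤ × ℤ, dyadRect q ⊂ dyadRect q' ∧ dyadRect q' ⊆ Ω

/-- The dyadic interval indexed by `p = (k, j)`. -/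
def dyad (p : ℤ × ℤ) : Set ℝ := Ico (dyadL p.1 p.2) (dyadR p.1 p.2)

/-- The index of the dyadic ancestor, `k` generations up. -/
def ancestor (k : ℕ) (p : ℤ × ℤ) : ℤ × ℤ := (p.1 + k, p.2 / ((2 ^ k : ℕ) : ℤ))

theorem mem_dyad_iff {p : ℤ × ℤ} {x : ℝ} : x ∈ dyad p ↔ ⌊x / (2:ℝ) ^ p.1⌋ = p.2 := by
  have h : (0:ℝ) < (2:ℝ) ^ p.1 := by positivity
  rw [Int.floor_eq_iff, le_div_iff₀ h, div_lt_iff₀ h, dyad, mem_Ico, dyadL, dyadR,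
    mul_comm ((2:ℝ) ^ p.1), mul_comm ((2:ℝ) ^ p.1)]

theorem floor_ancestor (x : ℝ) (m : ℤ) (k : ℕ) :
    ⌊x / (2:ℝ) ^ (m + k)⌋ = ⌊x / (2:ℝ) ^ m⌋ / ((2 ^ k : ℕ) : ℤ) := by
  rw [← Int.floor_div_natCast, zpow_add₀ two_ne_zero, div_div, zpow_natCast]
  norm_cast

theorem dyad_subset_ancestor (k : ℕ) (p : ℤ × ℤ) : dyad p ⊆ dyad (ancestor k p) := by
  intro x hx
  rw [mem_dyad_iff] at hx ⊢
  simp only [ancestor]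
  rw [floor_ancestor, hx]

theorem dyad_subset_of_mem {p q : ℤ × ℤ} {x : ℝ} (hp : x ∈ dyad p) (hq : x ∈ dyad q)
    (h : p.1 ≤ q.1) : dyad p ⊆ dyad q := by
  obtain ⟨n, hn⟩ := Int.le.dest h
  have : q = ancestor n p := by
    rw [mem_dyad_iff] at hp hq
    refine Prod.ext hn.symm ?_
    rw [← hq, ← hn, floor_ancestor, hp]
    rfl
  rw [this]
  exact dyad_subset_ancestor n p

theorem eq_of_mem_dyad {p q : ℤ × ℤ} {x : ℝ} (hp : x ∈ dyad p) (hq : x ∈ dyad q)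
    (h : p.1 = q.1) : p = q := by
  rw [mem_dyad_iff] at hp hq
  refine Prod.ext h ?_
  rw [← hp, ← hq, h]

theorem volume_dyad (p : ℤ × ℤ) : volume (dyad p) = ENNReal.ofReal ((2:ℝ) ^ p.1) := by
  rw [dyad, Real.volume_Ico, dyadL, dyadR]
  congr 1
  ring

theorem volume_dyad_ne_top (p : ℤ × ℤ) : volume (dyad p) ≠ ⊤ := by
  rw [volume_dyad]; exact ENNReal.ofReal_ne_top

theorem volume_dyad_ne_zero (p : ℤ × ℤ) : volume (dyad p) ≠ 0 := by
  rw [volume_dyad]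
  have : (0:ℝ) < (2:ℝ) ^ p.1 := by positivity
  simpa using this

theorem dyad_nonempty (p : ℤ × ℤ) : (dyad p).Nonempty :=
  nonempty_of_measure_ne_zero (volume_dyad_ne_zero p)

theorem measurableSet_dyad (p : ℤ × ℤ) : MeasurableSet (dyad p) := measurableSet_Ico

theorem scale_le_of_subset {p q : ℤ × ℤ} (h : dyad p ⊆ dyad q) : p.1 ≤ q.1 := by
  have := measure_mono (μ := volume) h
  rw [volume_dyad, volume_dyad, ENNReal.ofReal_le_ofReal_iff (by positivity)] at this
  exact (zpow_le_zpow_iff_right₀ one_lt_two).1 this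

/-- The pairs in `s` whose dyadic interval is maximal among those with the same label. -/
def maximalDyads {β : Type*} (s : Finset ((ℤ × ℤ) × β)) : Set ((ℤ × ℤ) × β) :=
  {a | a ∈ s ∧ ∀ b ∈ s, b.2 = a.2 → dyad a.1 ⊆ dyad b.1 → b = a}

theorem exists_maximalDyads {β : Type*} (s : Finset ((ℤ × ℤ) × β))
    {a : (ℤ × ℤ) × β} (ha : a ∈ s) :
    ∃ b ∈ maximalDyads s, b.2 = a.2 ∧ dyad a.1 ⊆ dyad b.1 := by
  classical
  obtain ⟨b, hb, hmax⟩ := Finset.exists_max_image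
    (s.filter fun b => b.2 = a.2 ∧ dyad a.1 ⊆ dyad b.1) (fun b => b.1.1) ⟨a, by simp [ha]⟩
  rw [Finset.mem_filter] at hb
  refine ⟨b, ⟨hb.1, fun c hc hcb hsub => ?_⟩, hb.2⟩
  have h1 := hmax c (Finset.mem_filter.2 ⟨hc, hcb.trans hb.2.1, hb.2.2.trans hsub⟩)
  have h2 := scale_le_of_subset hsub
  obtain ⟨x, hx⟩ := dyad_nonempty b.1
  exact Prod.ext (eq_of_mem_dyad (hsub hx) hx (le_antisymm h1 h2)) hcb

theorem disjoint_of_maximalDyads {β : Type*} {s : Finset ((ℤ × ℤ) × β)}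
    {a b : (ℤ × ℤ) × β} (ha : a ∈ maximalDyads s) (hb : b ∈ maximalDyads s) (hab : a ≠ b)
    (h : a.2 = b.2) : Disjoint (dyad a.1) (dyad b.1) := by
  rw [Set.disjoint_left]
  intro x hxa hxb
  rcases le_total a.1.1 b.1.1 with hs | hs
  · exact hab (ha.2 b hb.1 h.symm (dyad_subset_of_mem hxa hxb hs)).symm
  · exact hab (hb.2 a ha.1 h (dyad_subset_of_mem hxb hxa hs))

/-- Union of the dyadic intervals `I` with `I × J ⊆ U`. -/
def fiberDyads (U : Set (ℝ × ℝ)) (J : ℤ × ℤ) : Set ℝ :=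
  ⋃ I : {I : ℤ × ℤ // dyad I ×ˢ dyad J ⊆ U}, dyad I.1

theorem measurableSet_fiberDyads (U : Set (ℝ × ℝ)) (J : ℤ × ℤ) :
    MeasurableSet (fiberDyads U J) :=
  MeasurableSet.iUnion fun _ => measurableSet_dyad _

theorem fiberDyads_prod_subset (U : Set (ℝ × ℝ)) (J : ℤ × ℤ) :
    fiberDyads U J ×ˢ dyad J ⊆ U := by
  rintro ⟨x, y⟩ ⟨hx, hy⟩
  obtain ⟨I, hI⟩ := mem_iUnion.1 hx
  exact I.2 ⟨hI, hy⟩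

theorem dyad_subset_fiberDyads {U : Set (ℝ × ℝ)} {I J J' : ℤ × ℤ}
    (h : dyad I ×ˢ dyad J ⊆ U) (hJ : dyad J' ⊆ dyad J) : dyad I ⊆ fiberDyads U J' :=
  subset_iUnion (fun I : {I : ℤ × ℤ // dyad I ×ˢ dyad J' ⊆ U} => dyad I.1)
    ⟨I, (prod_mono_right hJ).trans h⟩

theorem volume_dyad_le_two_mul_diff {U : Set (ℝ × ℝ)} {I J : ℤ × ℤ}
    (h : 2 * volume (U ∩ dyad I ×ˢ dyad J) ≤ volume (dyad I) * volume (dyad J)) :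
    volume (dyad I) ≤ 2 * volume (dyad I \ fiberDyads U J) := by
  have hsub : (dyad I ∩ fiberDyads U J) ×ˢ dyad J ⊆ U ∩ dyad I ×ˢ dyad J := by
    rintro ⟨x, y⟩ ⟨hx, hy⟩
    exact ⟨fiberDyads_prod_subset U J ⟨hx.2, hy⟩, hx.1, hy⟩
  have h1 := measure_mono (μ := volume) hsub
  rw [Measure.volume_eq_prod, Measure.prod_prod, ← Measure.volume_eq_prod] at h1
  have h2 : 2 * volume (dyad I ∩ fiberDyads U J) ≤ volume (dyad I) := by
    rw [← ENNReal.mul_le_mul_iff_left (volume_dyad_ne_zero J) (volume_dyad_ne_top J), mul_assoc]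
    exact (mul_le_mul_right h1 2).trans h
  have h3 := measure_inter_add_sdiff (μ := volume) (dyad I) (measurableSet_fiberDyads U J)
  have hf : volume (dyad I ∩ fiberDyads U J) ≠ ⊤ :=
    ne_top_of_le_ne_top (volume_dyad_ne_top I) (measure_mono inter_subset_left)
  rw [two_mul] at h2
  rw [← h3] at h2
  have h4 := (ENNReal.add_le_add_iff_left hf).1 h2
  rw [← h3, two_mul]
  gcongr

/-- One-directional packing: rectangles `I × J` inside `U`, disjoint for fixed `J`, whose
vertical enlargement by `k` generations is at most half filled by `U`. -/
theorem sum_volume_le_of_half {U : Set (ℝ × ℝ)} {k : ℕ} (hk : 0 < k)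
    (P : Finset ((ℤ × ℤ) × ℤ × ℤ))
    (hU : ∀ a ∈ P, dyad a.1 ×ˢ dyad a.2 ⊆ U)
    (hhalf : ∀ a ∈ P, 2 * volume (U ∩ dyad a.1 ×ˢ dyad (ancestor k a.2)) ≤
      volume (dyad a.1) * volume (dyad (ancestor k a.2)))
    (hdisj : ∀ a ∈ P, ∀ b ∈ P, a ≠ b → a.2 = b.2 → Disjoint (dyad a.1) (dyad b.1)) :
    ∑ a ∈ P, volume (dyad a.1) * volume (dyad a.2) ≤ 2 * k * volume U := by
  classical
  set g : (ℤ × ℤ) × ℤ × ℤ → Set (ℝ × ℝ) := fun a =>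
    (dyad a.1 \ fiberDyads U (ancestor k a.2)) ×ˢ dyad a.2 with hg
  have hterm : ∀ a ∈ P, volume (dyad a.1) * volume (dyad a.2) ≤ 2 * volume (g a) := by
    intro a ha
    rw [hg, Measure.volume_eq_prod, Measure.prod_prod, ← mul_assoc]
    gcongr
    exact volume_dyad_le_two_mul_diff (hhalf a ha)
  have key : ∀ a ∈ P, ∀ b ∈ P, a ≠ b → a.2.1 % (k:ℤ) = b.2.1 % (k:ℤ) → a.2.1 ≤ b.2.1 →
      Disjoint (g a) (g b) := by
    intro a ha b hb hab hmod hle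
    rw [Set.disjoint_left]
    rintro ⟨x, y⟩ ⟨⟨hxa, hxa'⟩, hya⟩ ⟨⟨hxb, -⟩, hyb⟩
    simp only at hxa hxa' hya hxb hyb
    rcases hle.eq_or_lt with he | hlt
    · exact Set.disjoint_left.1 (hdisj a ha b hb hab (eq_of_mem_dyad hya hyb he)) hxa hxb
    · have hge : a.2.1 + k ≤ b.2.1 := by
        obtain ⟨c, hc⟩ := Int.ModEq.dvd (n := (k:ℤ)) hmod
        have : 0 < c := by
          by_contra! hc0
          nlinarith
        nlinarith
      exact hxa' (dyad_subset_fiberDyads (hU b hb)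
        (dyad_subset_of_mem (dyad_subset_ancestor k _ hya) hyb hge) hxb)
  have hcls : ∀ r ∈ Finset.range k,
      ∑ a ∈ P with a.2.1 % (k:ℤ) = (r:ℤ), volume (g a) ≤ volume U := by
    intro r _
    rw [← measure_biUnion_finset]
    · refine measure_mono (iUnion₂_subset fun a ha => ?_)
      exact (prod_mono_left sdiff_subset).trans (hU a (Finset.mem_filter.1 ha).1)
    · intro a ha b hb hab
      obtain ⟨haP, har⟩ := Finset.mem_filter.1 ha
      obtain ⟨hbP, hbr⟩ := Finset.mem_filter.1 hb
      rcases le_total a.2.1 b.2.1 with h | h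
      · exact key a haP b hbP hab (har.trans hbr.symm) h
      · exact (key b hbP a haP hab.symm (hbr.trans har.symm) h).symm
    · intro a _
      exact ((measurableSet_dyad _).diff (measurableSet_fiberDyads _ _)).prod
        (measurableSet_dyad _)
  have hmaps : ∀ a ∈ P, (a.2.1 % (k:ℤ)).toNat ∈ Finset.range k := by
    intro a _
    have h1 := Int.emod_lt_of_pos a.2.1 (by exact_mod_cast hk : (0:ℤ) < k)
    have h2 := Int.emod_nonneg a.2.1 (by exact_mod_cast hk.ne' : (k:ℤ) ≠ 0)
    rw [Finset.mem_range]
    omega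
  calc ∑ a ∈ P, volume (dyad a.1) * volume (dyad a.2)
      ≤ ∑ a ∈ P, 2 * volume (g a) := Finset.sum_le_sum hterm
    _ = 2 * ∑ r ∈ Finset.range k, ∑ a ∈ P with (a.2.1 % (k:ℤ)).toNat = r, volume (g a) := by
        rw [← Finset.mul_sum, Finset.sum_fiberwise_of_maps_to hmaps]
    _ = 2 * ∑ r ∈ Finset.range k, ∑ a ∈ P with a.2.1 % (k:ℤ) = (r:ℤ), volume (g a) := by
        congr 1
        refine Finset.sum_congr rfl fun r _ => ?_
        congr 1
        refine Finset.filter_congr fun a _ => ?_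
        have h2 := Int.emod_nonneg a.2.1 (by exact_mod_cast hk.ne' : (k:ℤ) ≠ 0)
        omega
    _ ≤ 2 * ∑ r ∈ Finset.range k, volume U := by
        gcongr with r hr
        exact hcls r hr
    _ = 2 * k * volume U := by
        rw [Finset.sum_const, Finset.card_range, nsmul_eq_mul, mul_assoc]

/-- Union of the dyadic intervals more than a quarter filled by `A`. -/
def quarterDyads (A : Set ℝ) : Set ℝ :=
  ⋃ I : {I : ℤ × ℤ // volume (dyad I) < 4 * volume (A ∩ dyad I)}, dyad I.1

theorem volume_quarterDyads_le {A : Set ℝ} (hA : MeasurableSet A) :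
    volume (quarterDyads A) ≤ 4 * volume A := by
  classical
  rw [quarterDyads, Set.iUnion_eq_iUnion_finset, Directed.measure_iUnion]
  swap
  · refine directed_of_isDirected_le fun s t hst => ?_
    exact biUnion_subset_biUnion_left hst
  refine iSup_le fun s => ?_
  set s' : Finset ((ℤ × ℤ) × Unit) := s.image fun I => (I.1, ()) with hs'
  set M := s'.filter (· ∈ maximalDyads s') with hM
  have hq : ∀ a ∈ M, volume (dyad a.1) ≤ 4 * volume (A ∩ dyad a.1) := by
    intro a ha
    obtain ⟨I, -, rfl⟩ := Finset.mem_image.1 (Finset.mem_filter.1 ha).1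
    exact I.2.le
  calc volume (⋃ I ∈ s, dyad I.1) ≤ volume (⋃ a ∈ M, dyad a.1) := by
        refine measure_mono (iUnion₂_subset fun I hI => ?_)
        obtain ⟨b, hb, -, hsub⟩ := exists_maximalDyads s' (a := (I.1, ()))
          (Finset.mem_image.2 ⟨I, hI, rfl⟩)
        exact hsub.trans (subset_biUnion_of_mem (u := fun a : (ℤ × ℤ) × Unit => dyad a.1)
          (show b ∈ (M : Set _) from Finset.mem_coe.2 (Finset.mem_filter.2 ⟨hb.1, hb⟩)))
    _ ≤ ∑ a ∈ M, volume (dyad a.1) := measure_biUnion_finset_le _ _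
    _ ≤ ∑ a ∈ M, 4 * volume (A ∩ dyad a.1) := Finset.sum_le_sum hq
    _ = 4 * volume (⋃ a ∈ M, A ∩ dyad a.1) := by
        rw [← Finset.mul_sum, measure_biUnion_finset]
        · intro a ha b hb hab
          exact (disjoint_of_maximalDyads (Finset.mem_filter.1 ha).2 (Finset.mem_filter.1 hb).2
            hab rfl).mono inter_subset_right inter_subset_right
        · exact fun a _ => hA.inter (measurableSet_dyad _)
    _ ≤ 4 * volume A := by
        gcongr
        exact iUnion₂_subset fun a _ => inter_subset_left

/-- The set obtained from `U` by applying `quarterDyads` to all horizontal slices. -/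
def quarterFst (U : Set (ℝ × ℝ)) : Set (ℝ × ℝ) :=
  {z | z.1 ∈ quarterDyads {x | (x, z.2) ∈ U}}

theorem measurableSet_quarterFst {U : Set (ℝ × ℝ)} (hU : MeasurableSet U) :
    MeasurableSet (quarterFst U) := by
  have : quarterFst U = ⋃ I : ℤ × ℤ, dyad I ×ˢ
      {y | volume (dyad I) < 4 * volume ({x | (x, y) ∈ U} ∩ dyad I)} := by
    ext ⟨x, y⟩
    simp [quarterFst, quarterDyads, and_comm]
  rw [this]
  refine MeasurableSet.iUnion fun I => (measurableSet_dyad I).prod ?_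
  refine measurableSet_lt measurable_const (Measurable.const_mul ?_ _)
  have := measurable_measure_prodMk_right (μ := (volume : Measure ℝ))
    (hU.inter ((measurableSet_dyad I).prod MeasurableSet.univ))
  convert this using 2 with y
  congr 1
  ext x
  simp

theorem volume_quarterFst_le {U : Set (ℝ × ℝ)} (hU : MeasurableSet U) :
    volume (quarterFst U) ≤ 4 * volume U := by
  rw [Measure.volume_eq_prod, Measure.prod_apply_symm (measurableSet_quarterFst hU),
    Measure.prod_apply_symm hU, ← lintegral_const_mul' _ _ (by norm_num)]
  exact lintegral_mono fun y => volume_quarterDyads_le (measurable_prodMk_right hU)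

theorem volume_preimage_swap {U : Set (ℝ × ℝ)} (hU : MeasurableSet U) :
    volume (Prod.swap ⁻¹' U) = volume U :=
  (Measure.measurePreserving_swap (μ := (volume : Measure ℝ)) (ν := (volume : Measure ℝ))
    ).measure_preimage hU.nullMeasurableSet

/-- Union of the dyadic rectangles more than half filled by `U`. -/
def halfRects (U : Set (ℝ × ℝ)) : Set (ℝ × ℝ) :=
  ⋃ q : {q : (ℤ × ℤ) × ℤ × ℤ //
    volume (dyad q.1) * volume (dyad q.2) < 2 * volume (U ∩ dyad q.1 ×ˢ dyad q.2)},
    dyad q.1.1 ×ˢ dyad q.1.2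

theorem measurableSet_halfRects (U : Set (ℝ × ℝ)) : MeasurableSet (halfRects U) :=
  MeasurableSet.iUnion fun _ => (measurableSet_dyad _).prod (measurableSet_dyad _)

theorem subset_halfRects {U : Set (ℝ × ℝ)} {I J : ℤ × ℤ}
    (h : volume (dyad I) * volume (dyad J) < 2 * volume (U ∩ dyad I ×ˢ dyad J)) :
    dyad I ×ˢ dyad J ⊆ halfRects U :=
  subset_iUnion (fun q : {q : (ℤ × ℤ) × ℤ × ℤ //
    volume (dyad q.1) * volume (dyad q.2) < 2 * volume (U ∩ dyad q.1 ×ˢ dyad q.2)} =>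
    dyad q.1.1 ×ˢ dyad q.1.2) ⟨(I, J), h⟩

/-- A half-filled rectangle has a quarter-filled slice of many heights. -/
theorem volume_dyad_lt_of_half {U : Set (ℝ × ℝ)} (hU : MeasurableSet U) {I J : ℤ × ℤ}
    (h : volume (dyad I) * volume (dyad J) < 2 * volume (U ∩ dyad I ×ˢ dyad J)) :
    volume (dyad J) <
      4 * volume ({y | volume (dyad I) < 4 * volume ({x | (x, y) ∈ U} ∩ dyad I)} ∩ dyad J) := by
  set Y := {y | volume (dyad I) < 4 * volume ({x | (x, y) ∈ U} ∩ dyad I)} with hY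
  set f : ℝ → ℝ≥0∞ := fun y => volume ({x | (x, y) ∈ U} ∩ dyad I) with hf
  have hfm : Measurable f := by
    have := measurable_measure_prodMk_right (μ := (volume : Measure ℝ))
      (hU.inter ((measurableSet_dyad I).prod MeasurableSet.univ))
    convert this using 2 with y
    simp only [hf]
    congr 1
    ext x
    simp
  have hYm : MeasurableSet Y := measurableSet_lt measurable_const (hfm.const_mul _)
  have h4 : 4 * volume (U ∩ dyad I ×ˢ dyad J) ≤
      volume (dyad I) * volume (dyad J) + 4 * (volume (dyad I) * volume (Y ∩ dyad J)) := by
    have e : volume (U ∩ dyad I ×ˢ dyad J) = ∫⁻ y in dyad J, f y := by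
      rw [Measure.volume_eq_prod, Measure.prod_apply_symm
        (hU.inter ((measurableSet_dyad I).prod (measurableSet_dyad J))),
        ← lintegral_indicator (measurableSet_dyad J)]
      congr 1
      ext y
      by_cases hy : y ∈ dyad J
      · rw [indicator_of_mem hy]
        simp only [hf]
        congr 1
        ext x
        simp [hy]
      · rw [indicator_of_notMem hy]
        convert measure_empty (μ := (volume : Measure ℝ))
        ext x
        simp [hy]
    rw [e, ← lintegral_const_mul' _ _ (by norm_num)]
    calc ∫⁻ y in dyad J, 4 * f y
        ≤ ∫⁻ y in dyad J, (volume (dyad I) +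
            Y.indicator (fun _ => 4 * volume (dyad I)) y) := by
          refine lintegral_mono fun y => ?_
          by_cases hy : y ∈ Y
          · rw [indicator_of_mem hy]
            refine le_add_left ?_
            gcongr
            exact measure_mono inter_subset_right
          · rw [indicator_of_notMem hy, add_zero]
            exact not_lt.1 hy
      _ = _ := by
          rw [lintegral_add_left measurable_const, lintegral_indicator hYm,
            Measure.restrict_restrict hYm, lintegral_const, lintegral_const,
            Measure.restrict_apply_univ, Measure.restrict_apply_univ, mul_assoc]
  have hI := volume_dyad_ne_zero I
  have hI' := volume_dyad_ne_top I
  have hfin : volume (dyad I) * volume (dyad J) ≠ ⊤ :=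
    ENNReal.mul_ne_top hI' (volume_dyad_ne_top J)
  have h5 : 2 * (volume (dyad I) * volume (dyad J)) <
      volume (dyad I) * volume (dyad J) + 4 * (volume (dyad I) * volume (Y ∩ dyad J)) := by
    refine lt_of_lt_of_le ?_ h4
    have := (ENNReal.mul_lt_mul_iff_right (a := 2) (by norm_num) (by norm_num)).2 h
    rw [← mul_assoc 2 2] at this
    convert this using 2
    norm_num
  rw [two_mul, ENNReal.add_lt_add_iff_left hfin, mul_left_comm] at h5
  exact (ENNReal.mul_lt_mul_iff_right hI hI').1 h5

theorem volume_halfRects_le {U : Set (ℝ × ℝ)} (hU : MeasurableSet U) :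
    volume (halfRects U) ≤ 16 * volume U := by
  set G := quarterFst U with hG
  have hGm : MeasurableSet G := measurableSet_quarterFst hU
  have hGs : MeasurableSet (Prod.swap ⁻¹' G) := measurable_swap hGm
  have hsub : halfRects U ⊆ Prod.swap ⁻¹' quarterFst (Prod.swap ⁻¹' G) := by
    refine iUnion_subset ?_
    rintro ⟨⟨I, J⟩, h⟩ ⟨x, y⟩ ⟨hx, hy⟩
    simp only at h hx hy
    have h1 := volume_dyad_lt_of_half hU h
    refine mem_iUnion.2 ⟨⟨J, h1.trans_le ?_⟩, hy⟩
    refine mul_le_mul_right (measure_mono (inter_subset_inter_left _ fun y' hy' => ?_)) 4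
    exact mem_iUnion.2 ⟨⟨I, hy'⟩, hx⟩
  calc volume (halfRects U)
      ≤ volume (Prod.swap ⁻¹' quarterFst (Prod.swap ⁻¹' G)) := measure_mono hsub
    _ = volume (quarterFst (Prod.swap ⁻¹' G)) :=
        volume_preimage_swap (measurableSet_quarterFst hGs)
    _ ≤ 4 * volume (Prod.swap ⁻¹' G) := volume_quarterFst_le hGs
    _ = 4 * volume G := by rw [volume_preimage_swap hGm]
    _ ≤ 4 * (4 * volume U) := by gcongr; exact volume_quarterFst_le hU
    _ = 16 * volume U := by rw [← mul_assoc]; norm_num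

theorem dyadRect_eq (q : (ℤ × ℤ) × ℤ × ℤ) : dyadRect q = dyad q.1 ×ˢ dyad q.2 := rfl

theorem volume_dyadRect_s15 (q : (ℤ × ℤ) × ℤ × ℤ) :
    volume (dyadRect q) = volume (dyad q.1) * volume (dyad q.2) := by
  rw [dyadRect_eq, Measure.volume_eq_prod, Measure.prod_prod]

theorem IsMaximalIn.disjoint_fst {Ω : Set (ℝ × ℝ)} {a b : (ℤ × ℤ) × ℤ × ℤ}
    (ha : IsMaximalIn Ω a) (hb : IsMaximalIn Ω b) (hab : a ≠ b) (h : a.2 = b.2) :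
    Disjoint (dyad a.1) (dyad b.1) := by
  have key : ∀ {a b : (ℤ × ℤ) × ℤ × ℤ}, IsMaximalIn Ω a → IsMaximalIn Ω b → a ≠ b →
      a.2 = b.2 → ∀ x ∈ dyad a.1, x ∈ dyad b.1 → ¬ a.1.1 ≤ b.1.1 := by
    intro a b ha hb hab h x hxa hxb hle
    refine ha.2 ⟨b, ⟨?_, fun hsub => ?_⟩, hb.1⟩
    · rw [dyadRect_eq, dyadRect_eq, h]
      exact prod_mono_left (dyad_subset_of_mem hxa hxb hle)
    · rw [dyadRect_eq, dyadRect_eq, h] at hsub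
      have h1 : dyad b.1 ⊆ dyad a.1 := by
        obtain ⟨y, hy⟩ := dyad_nonempty b.2
        exact fun z hz => (hsub (show (z, y) ∈ _ from ⟨hz, hy⟩)).1
      exact hab (Prod.ext
        (eq_of_mem_dyad hxa hxb (le_antisymm hle (scale_le_of_subset h1))) h)
  rw [Set.disjoint_left]
  intro x hxa hxb
  rcases le_total a.1.1 b.1.1 with hs | hs
  · exact key ha hb hab h x hxa hxb hs
  · exact key hb ha hab.symm h.symm x hxb hxa hs

theorem preimage_swap_dyads (I J : ℤ × ℤ) :
    Prod.swap ⁻¹' (dyad I ×ˢ dyad J) = dyad J ×ˢ dyad I := preimage_swap_prod _ _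

theorem IsMaximalIn.swap {Ω : Set (ℝ × ℝ)} {q : (ℤ × ℤ) × ℤ × ℤ} (h : IsMaximalIn Ω q) :
    IsMaximalIn (Prod.swap ⁻¹' Ω) q.swap := by
  have hinj : ∀ {s t : Set (ℝ × ℝ)}, Prod.swap ⁻¹' s ⊆ Prod.swap ⁻¹' t ↔ s ⊆ t :=
    Prod.swap_surjective.preimage_subset_preimage_iff
  have hr : ∀ q, dyadRect (Prod.swap q) = Prod.swap ⁻¹' dyadRect q := fun q =>
    (preimage_swap_dyads q.1 q.2).symm
  refine ⟨by rw [hr]; exact preimage_mono h.1, ?_⟩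
  rintro ⟨q', hlt, hsub⟩
  refine h.2 ⟨q'.swap, ?_, ?_⟩
  · rw [← Prod.swap_swap q', hr, hr] at hlt
    exact ⟨hinj.1 hlt.1, fun hh => hlt.2 (hinj.2 hh)⟩
  · rw [← Prod.swap_swap q', hr] at hsub
    exact hinj.1 hsub

/-- Packing for maximal rectangles whose horizontal enlargement is at most half filled. -/
theorem sum_volume_le_of_half_fst {Ω : Set (ℝ × ℝ)} (hΩ : MeasurableSet Ω) {k : ℕ} (hk : 0 < k)
    (T : Finset ((ℤ × ℤ) × ℤ × ℤ)) (hmax : ∀ q ∈ T, IsMaximalIn Ω q)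
    (hhalf : ∀ q ∈ T, 2 * volume (Ω ∩ dyad (ancestor k q.1) ×ˢ dyad q.2) ≤
      volume (dyad (ancestor k q.1)) * volume (dyad q.2)) :
    ∑ q ∈ T, volume (dyadRect q) ≤ 2 * k * volume Ω := by
  classical
  have key := sum_volume_le_of_half (U := Prod.swap ⁻¹' Ω) hk (T.image Prod.swap) ?_ ?_ ?_
  · rw [Finset.sum_image Prod.swap_injective.injOn, volume_preimage_swap hΩ] at key
    refine le_trans (le_of_eq ?_) key
    refine Finset.sum_congr rfl fun q _ => ?_
    rw [volume_dyadRect_s15, mul_comm]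
    rfl
  · rw [Finset.forall_mem_image]
    exact fun q hq => (hmax q hq).swap.1
  · rw [Finset.forall_mem_image]
    intro q hq
    simp only [Prod.fst_swap, Prod.snd_swap]
    rw [← preimage_swap_dyads, ← preimage_inter, volume_preimage_swap
      (hΩ.inter ((measurableSet_dyad _).prod (measurableSet_dyad _))),
      mul_comm (volume (dyad q.2))]
    exact hhalf q hq
  · simp only [Finset.forall_mem_image]
    exact fun a ha b hb hab h => (hmax a ha).swap.disjoint_fst (hmax b hb).swap hab h

/-- Packing for maximal rectangles whose horizontal enlargement lies in `U`, but whose joint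
enlargement is at most half filled by `U`. -/
theorem sum_volume_le_of_half_snd {Ω U : Set (ℝ × ℝ)} {k : ℕ} (hk : 0 < k)
    (T : Finset ((ℤ × ℤ) × ℤ × ℤ)) (hmax : ∀ q ∈ T, IsMaximalIn Ω q)
    (hU : ∀ q ∈ T, dyad (ancestor k q.1) ×ˢ dyad q.2 ⊆ U)
    (hhalf : ∀ q ∈ T, 2 * volume (U ∩ dyad (ancestor k q.1) ×ˢ dyad (ancestor k q.2)) ≤
      volume (dyad (ancestor k q.1)) * volume (dyad (ancestor k q.2))) :
    ∑ q ∈ T, volume (dyadRect q) ≤ 2 * k * volume U := by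
  classical
  set P : Finset ((ℤ × ℤ) × ℤ × ℤ) := T.image fun q => (ancestor k q.1, q.2) with hP
  set M := P.filter (· ∈ maximalDyads P) with hM
  have hex : ∀ q : (ℤ × ℤ) × ℤ × ℤ, ∃ b, q ∈ T → b ∈ M ∧ b.2 = q.2 ∧
      dyad q.1 ⊆ dyad b.1 := by
    intro q
    by_cases hq : q ∈ T
    · obtain ⟨b, hb, h2, hsub⟩ := exists_maximalDyads P (a := (ancestor k q.1, q.2))
        (Finset.mem_image.2 ⟨q, hq, rfl⟩)
      exact ⟨b, fun _ => ⟨Finset.mem_filter.2 ⟨hb.1, hb⟩, h2,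
        (dyad_subset_ancestor k q.1).trans hsub⟩⟩
    · exact ⟨q, fun h => absurd h hq⟩
  choose g hg using hex
  have hfib : ∀ b ∈ M, ∑ q ∈ T with g q = b, volume (dyadRect q) ≤
      volume (dyad b.1) * volume (dyad b.2) := by
    intro b _
    have hmem : ∀ q ∈ T.filter (g · = b), q ∈ T ∧ b.2 = q.2 ∧ dyad q.1 ⊆ dyad b.1 := by
      intro q hq
      obtain ⟨hqT, rfl⟩ := Finset.mem_filter.1 hq
      exact ⟨hqT, (hg q hqT).2⟩
    calc ∑ q ∈ T with g q = b, volume (dyadRect q)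
        = ∑ q ∈ T with g q = b, volume (dyad q.1) * volume (dyad b.2) := by
          refine Finset.sum_congr rfl fun q hq => ?_
          rw [volume_dyadRect_s15, (hmem q hq).2.1]
      _ = volume (⋃ q ∈ T.filter (g · = b), dyad q.1) * volume (dyad b.2) := by
          rw [← Finset.sum_mul, measure_biUnion_finset]
          · intro q hq q' hq' hne
            have h1 := hmem q hq
            have h2 := hmem q' hq'
            exact (hmax q h1.1).disjoint_fst (hmax q' h2.1) hne (h1.2.1.symm.trans h2.2.1)
          · exact fun q _ => measurableSet_dyad _
      _ ≤ volume (dyad b.1) * volume (dyad b.2) := by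
          refine mul_le_mul_left (measure_mono (iUnion₂_subset fun q hq => ?_)) _
          exact (hmem q hq).2.2
  have hMP : ∀ b ∈ M, ∃ q ∈ T, (ancestor k q.1, q.2) = b := fun b hb =>
    Finset.mem_image.1 (Finset.mem_filter.1 hb).1
  calc ∑ q ∈ T, volume (dyadRect q)
      = ∑ b ∈ M, ∑ q ∈ T with g q = b, volume (dyadRect q) :=
        (Finset.sum_fiberwise_of_maps_to (fun q hq => (hg q hq).1) _).symm
    _ ≤ ∑ b ∈ M, volume (dyad b.1) * volume (dyad b.2) := Finset.sum_le_sum hfib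
    _ ≤ 2 * k * volume U := by
        refine sum_volume_le_of_half hk M ?_ ?_ ?_
        · intro b hb
          obtain ⟨q, hq, rfl⟩ := hMP b hb
          exact hU q hq
        · intro b hb
          obtain ⟨q, hq, rfl⟩ := hMP b hb
          exact hhalf q hq
        · intro a ha b hb hab h
          exact disjoint_of_maximalDyads (Finset.mem_filter.1 ha).2 (Finset.mem_filter.1 hb).2
            hab h

/-- Packing for maximal rectangles whose `k`-th joint ancestor is at most half filled by
`halfRects Ω`. -/
theorem sum_volume_le_of_half_halfRects {Ω : Set (ℝ × ℝ)} (hΩ : MeasurableSet Ω) {k : ℕ}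
    (hk : 0 < k) (T : Finset ((ℤ × ℤ) × ℤ × ℤ)) (hmax : ∀ q ∈ T, IsMaximalIn Ω q)
    (hhalf : ∀ q ∈ T,
      2 * volume (halfRects Ω ∩ dyad (ancestor k q.1) ×ˢ dyad (ancestor k q.2)) ≤
        volume (dyad (ancestor k q.1)) * volume (dyad (ancestor k q.2))) :
    ∑ q ∈ T, volume (dyadRect q) ≤ 34 * k * volume Ω := by
  classical
  rw [← Finset.sum_filter_add_sum_filter_not T (fun q =>
    2 * volume (Ω ∩ dyad (ancestor k q.1) ×ˢ dyad q.2) ≤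
      volume (dyad (ancestor k q.1)) * volume (dyad q.2))]
  have h1 := sum_volume_le_of_half_fst hΩ hk (T.filter fun q =>
    2 * volume (Ω ∩ dyad (ancestor k q.1) ×ˢ dyad q.2) ≤
      volume (dyad (ancestor k q.1)) * volume (dyad q.2))
    (fun q hq => hmax q (Finset.mem_filter.1 hq).1) (fun q hq => (Finset.mem_filter.1 hq).2)
  have h2 := sum_volume_le_of_half_snd (U := halfRects Ω) hk (T.filter fun q =>
    ¬ 2 * volume (Ω ∩ dyad (ancestor k q.1) ×ˢ dyad q.2) ≤
      volume (dyad (ancestor k q.1)) * volume (dyad q.2))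
    (fun q hq => hmax q (Finset.mem_filter.1 hq).1)
    (fun q hq => subset_halfRects (not_le.1 (Finset.mem_filter.1 hq).2))
    (fun q hq => hhalf q (Finset.mem_filter.1 hq).1)
  calc _ ≤ 2 * k * volume Ω + 2 * k * (16 * volume Ω) :=
        add_le_add h1 (h2.trans (mul_le_mul_right (volume_halfRects_le hΩ) _))
    _ = 34 * k * volume Ω := by ring

theorem average_indicator_le_one (U : Set (ℝ × ℝ)) {a b c d : ℝ} (hab : a < b)
    (hcd : c < d) :
    ((b - a) * (d - c))⁻¹ * ∫ q in Ioo a b ×ˢ Ioo c d, |U.indicator (1 : ℝ × ℝ → ℝ) q| ≤ 1 := by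
  have hpos : 0 < (b - a) * (d - c) := mul_pos (sub_pos.2 hab) (sub_pos.2 hcd)
  have hv : volume (Ioo a b ×ˢ Ioo c d) = ENNReal.ofReal ((b - a) * (d - c)) := by
    rw [Measure.volume_eq_prod, Measure.prod_prod, Real.volume_Ioo, Real.volume_Ioo,
      ENNReal.ofReal_mul (sub_pos.2 hab).le]
  have h := norm_setIntegral_le_of_norm_le_const (μ := volume)
    (f := fun q => |U.indicator (1 : ℝ × ℝ → ℝ) q|) (C := 1)
    (s := Ioo a b ×ˢ Ioo c d) (by rw [hv]; exact ENNReal.ofReal_lt_top) (fun q _ => by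
      by_cases hq : q ∈ U <;> simp [hq])
  rw [one_mul, measureReal_def, hv, ENNReal.toReal_ofReal hpos.le] at h
  rw [inv_mul_le_iff₀ hpos, mul_one]
  exact (le_abs_self _).trans h

theorem bddAbove_averages (U : Set (ℝ × ℝ)) (x : ℝ × ℝ) :
    BddAbove {m : ℝ | ∃ a b c d : ℝ, a < b ∧ c < d ∧ x ∈ Ioo a b ×ˢ Ioo c d ∧
      m = ((b - a) * (d - c))⁻¹ *
        ∫ q in Ioo a b ×ˢ Ioo c d, |U.indicator (1 : ℝ × ℝ → ℝ) q|} := by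
  refine ⟨1, ?_⟩
  rintro m ⟨a, b, c, d, hab, hcd, -, rfl⟩
  exact average_indicator_le_one U hab hcd

theorem isOpen_enlarge (U : Set (ℝ × ℝ)) (ε : ℝ) : IsOpen (enlarge U ε) := by
  rw [isOpen_iff_mem_nhds]
  intro z hz
  have hz' : ε < MMax (U.indicator 1) z := hz
  rw [MMax] at hz'
  obtain ⟨m, ⟨a, b, c, d, hab, hcd, hzm, rfl⟩, hm⟩ := exists_lt_of_lt_csSup
    (by exact ⟨_, z.1 - 1, z.1 + 1, z.2 - 1, z.2 + 1, by linarith, by linarith,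
      ⟨⟨by linarith, by linarith⟩, ⟨by linarith, by linarith⟩⟩, rfl⟩) hz'
  filter_upwards [(isOpen_Ioo.prod isOpen_Ioo).mem_nhds hzm] with w hw
  exact hm.trans_le (le_csSup (bddAbove_averages U w) ⟨a, b, c, d, hab, hcd, hw, rfl⟩)

/-- A point lies in the enlargement as soon as some rectangle around it is filled enough. -/
theorem mem_enlarge {U S : Set (ℝ × ℝ)} (hU : MeasurableSet U) {ε a b c d : ℝ}
    (hε : 0 ≤ ε) {z : ℝ × ℝ} (hz : z ∈ Ioo a b ×ˢ Ioo c d) (hS : S ⊆ U) (hSR : S ⊆ Ioo a b ×ˢ Ioo c d)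
    (h : ENNReal.ofReal (ε * ((b - a) * (d - c))) < volume S) : z ∈ enlarge U ε := by
  have hab : a < b := hz.1.1.trans hz.1.2
  have hcd : c < d := hz.2.1.trans hz.2.2
  have hpos : 0 < (b - a) * (d - c) := mul_pos (sub_pos.2 hab) (sub_pos.2 hcd)
  refine lt_of_lt_of_le ?_ (le_csSup (bddAbove_averages U z) ⟨a, b, c, d, hab, hcd, hz, rfl⟩)
  have hi : ∫ q in Ioo a b ×ˢ Ioo c d, |U.indicator (1 : ℝ × ℝ → ℝ) q| =
      (volume (U ∩ Ioo a b ×ˢ Ioo c d)).toReal := by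
    have : (fun q => |U.indicator (1 : ℝ × ℝ → ℝ) q|) = U.indicator 1 := by
      ext q
      by_cases hq : q ∈ U <;> simp [hq]
    rw [this, integral_indicator_one hU, measureReal_def, Measure.restrict_apply hU]
  have hfin : volume (U ∩ Ioo a b ×ˢ Ioo c d) ≠ ⊤ := by
    refine ne_top_of_le_ne_top ?_ (measure_mono inter_subset_right)
    rw [Measure.volume_eq_prod, Measure.prod_prod, Real.volume_Ioo, Real.volume_Ioo]
    exact ENNReal.mul_ne_top ENNReal.ofReal_ne_top ENNReal.ofReal_ne_top
  rw [hi, lt_inv_mul_iff₀ hpos, mul_comm]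
  exact (ENNReal.ofReal_lt_iff_lt_toReal (mul_nonneg hε hpos.le) hfin).1 (h.trans_le (measure_mono (subset_inter hS hSR)))

theorem mem_enlarge_of_half {U V : Set (ℝ × ℝ)} (hU : MeasurableSet U) (hVU : V ⊆ U)
    {ε a b c d : ℝ} (hε : 0 ≤ ε) {z : ℝ × ℝ} (hz : z ∈ Ioo a b ×ˢ Ioo c d) {I J : ℤ × ℤ}
    (hI : dyad I ⊆ Ioo a b) (hJ : dyad J ⊆ Ioo c d)
    (h : volume (dyad I) * volume (dyad J) < 2 * volume (V ∩ dyad I ×ˢ dyad J))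
    (hle : 2 * (ε * ((b - a) * (d - c))) ≤ (2:ℝ) ^ I.1 * (2:ℝ) ^ J.1) : z ∈ enlarge U ε := by
  refine mem_enlarge hU hε hz (inter_subset_left.trans hVU)
    (inter_subset_right.trans (prod_mono hI hJ)) ?_
  rw [volume_dyad, volume_dyad, ← ENNReal.ofReal_mul (by positivity)] at h
  have h1 := (ENNReal.ofReal_le_ofReal hle).trans_lt h
  rw [ENNReal.ofReal_mul zero_le_two, ENNReal.ofReal_ofNat] at h1
  exact (ENNReal.mul_lt_mul_iff_right two_ne_zero ENNReal.ofNat_ne_top).1 h1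

theorem halfRects_subset_enlarge {Ω : Set (ℝ × ℝ)} (hΩ : MeasurableSet Ω) {ε : ℝ}
    (hε : ε ∈ Ioc (0:ℝ) (1/4)) : halfRects Ω ⊆ enlarge Ω ε := by
  refine iUnion_subset ?_
  rintro ⟨⟨I, J⟩, h⟩ z ⟨hz1, hz2⟩
  simp only at h hz1 hz2
  have key : ∀ p : ℤ × ℤ, dyad p ⊆ Ioo (dyadL p.1 p.2 - 2 ^ p.1 / 4) (dyadR p.1 p.2) := by
    intro p x hx
    have : (0:ℝ) < (2:ℝ) ^ p.1 := by positivity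
    exact ⟨by linarith [hx.1], hx.2⟩
  refine mem_enlarge_of_half hΩ subset_rfl hε.1.le ⟨key I hz1, key J hz2⟩ (key I) (key J) h ?_
  have e : ∀ p : ℤ × ℤ, dyadR p.1 p.2 - (dyadL p.1 p.2 - 2 ^ p.1 / 4) = 5 / 4 * (2:ℝ) ^ p.1 := by
    intro p
    rw [dyadL, dyadR]
    ring
  rw [e, e]
  have hp : (0:ℝ) < (2:ℝ) ^ I.1 * (2:ℝ) ^ J.1 := by positivity
  nlinarith [hε.2, hp]

/-- If the `k`-th joint ancestor of `q` is more than half filled by `halfRects Ω`, then the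
dilates of `q` by factors up to about `2 ^ k / √ε` lie in the double enlargement. -/
theorem dyadRectDil_subset_of_half {Ω : Set (ℝ × ℝ)} (hΩ : MeasurableSet Ω) {ε : ℝ}
    (hε : ε ∈ Ioc (0:ℝ) (1/4)) {k l : ℕ} (hk : 16 * (√ε * 2 ^ l) ≤ (2:ℝ) ^ k)
    {q : (ℤ × ℤ) × ℤ × ℤ}
    (h : volume (dyad (ancestor k q.1)) * volume (dyad (ancestor k q.2)) <
      2 * volume (halfRects Ω ∩ dyad (ancestor k q.1) ×ˢ dyad (ancestor k q.2))) :
    dyadRectDil (2 ^ (l + 1)) q ⊆ enlarge (enlarge Ω ε) ε := by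
  rintro z ⟨hz1, hz2⟩
  set L : ℤ × ℤ → ℝ := fun p =>
    dyadL (ancestor k p).1 (ancestor k p).2 - 2 ^ l * (2:ℝ) ^ p.1 with hL
  set R : ℤ × ℤ → ℝ := fun p =>
    dyadR (ancestor k p).1 (ancestor k p).2 + 2 ^ l * (2:ℝ) ^ p.1 with hR
  have hsub : ∀ p, dyad (ancestor k p) ⊆ Ioo (L p) (R p) := by
    intro p x hx
    have : (0:ℝ) < 2 ^ l * (2:ℝ) ^ p.1 := by positivity
    exact ⟨by simp only [hL]; linarith [hx.1], by simp only [hR]; linarith [hx.2]⟩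
  have hdil : ∀ (p : ℤ × ℤ) (x : ℝ),
      x ∈ Ico ((2:ℝ) ^ p.1 * ((p.2 : ℝ) + 1/2) - 2 ^ (l + 1) * (2:ℝ) ^ p.1 / 2)
        ((2:ℝ) ^ p.1 * ((p.2 : ℝ) + 1/2) + 2 ^ (l + 1) * (2:ℝ) ^ p.1 / 2) →
      x ∈ Ioo (L p) (R p) := by
    intro p x hx
    have hp : (0:ℝ) < (2:ℝ) ^ p.1 := by positivity
    have h0 : dyadL p.1 p.2 ∈ dyad p := ⟨le_rfl, by rw [dyadL, dyadR]; linarith⟩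
    have h1 : (2:ℝ) ^ p.1 * ((p.2 : ℝ) + 1/2) ∈ dyad p :=
      ⟨by rw [dyadL]; linarith, by rw [dyadR]; linarith⟩
    have h0' := (dyad_subset_ancestor k p h0).1
    have h1' := (dyad_subset_ancestor k p h1).2
    rw [show dyadL p.1 p.2 = (2:ℝ) ^ p.1 * (p.2 : ℝ) from rfl] at h0'
    rw [pow_succ] at hx
    exact ⟨by simp only [hL]; linarith [hx.1], by simp only [hR]; linarith [hx.2]⟩
  have hlen : ∀ p, R p - L p = (2 ^ k + 2 * 2 ^ l) * (2:ℝ) ^ p.1 := by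
    intro p
    simp only [hL, hR, dyadL, dyadR, ancestor, zpow_add₀ (two_ne_zero (α := ℝ)), zpow_natCast]
    ring
  refine mem_enlarge_of_half (isOpen_enlarge Ω ε).measurableSet
    (halfRects_subset_enlarge hΩ hε) hε.1.le ⟨hdil q.1 z.1 hz1, hdil q.2 z.2 hz2⟩
    (hsub q.1) (hsub q.2) h ?_
  rw [hlen, hlen]
  simp only [ancestor, zpow_add₀ (two_ne_zero (α := ℝ)), zpow_natCast]
  set s := √ε with hs
  have hs0 : 0 ≤ s := Real.sqrt_nonneg ε
  have hsq : s ^ 2 = ε := Real.sq_sqrt hε.1.le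
  have hs1 : s ≤ 1 / 2 := by nlinarith [hε.2]
  have h2k : (0:ℝ) < 2 ^ k := by positivity
  have hb : s * (2 ^ k + 2 * 2 ^ l) ≤ 5 / 8 * 2 ^ k := by nlinarith
  have hb0 : 0 ≤ s * (2 ^ k + 2 * 2 ^ l) := by positivity
  have hb2 : 2 * (s * (2 ^ k + 2 * 2 ^ l)) ^ 2 ≤ (2 ^ k) ^ 2 := by nlinarith
  have hp : (0:ℝ) < (2:ℝ) ^ q.1.1 * (2:ℝ) ^ q.2.1 := by positivity
  calc 2 * (ε * ((2 ^ k + 2 * 2 ^ l) * (2:ℝ) ^ q.1.1 * ((2 ^ k + 2 * 2 ^ l) * (2:ℝ) ^ q.2.1)))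
      = (2 * (s * (2 ^ k + 2 * 2 ^ l)) ^ 2) * ((2:ℝ) ^ q.1.1 * (2:ℝ) ^ q.2.1) := by
        rw [← hsq]; ring
    _ ≤ (2 ^ k) ^ 2 * ((2:ℝ) ^ q.1.1 * (2:ℝ) ^ q.2.1) := by gcongr
    _ = _ := by ring

/-- A logarithmic factor is dominated by any power. -/
theorem natCast_le_rpow {ν : ℝ} (hν : 0 < ν) (k : ℕ) {x : ℝ} (hx : 0 ≤ x)
    (h : (2:ℝ) ^ k ≤ 32 * x) : (k:ℝ) ≤ 32 ^ ν / (ν * Real.log 2) * x ^ ν := by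
  have hlog : 0 < Real.log 2 := Real.log_pos one_lt_two
  have h1 : (k:ℝ) * (ν * Real.log 2) ≤ ((2:ℝ) ^ k) ^ ν := by
    rw [Real.rpow_def_of_pos (by positivity), Real.log_pow]
    have := Real.add_one_le_exp ((k:ℝ) * Real.log 2 * ν)
    linarith
  have h2 : ((2:ℝ) ^ k) ^ ν ≤ 32 ^ ν * x ^ ν := by
    rw [← Real.mul_rpow (by norm_num) hx]
    exact Real.rpow_le_rpow (by positivity) h hν.le
  rw [div_mul_eq_mul_div, le_div_iff₀ (by positivity)]
  exact h1.trans h2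

/-- Lemma 4.4 of the paper, a Journé-type packing estimate: at each dilation level `l`,
the total measure of the maximal dyadic rectangles in the class `𝒦_l` is controlled by
`(√ε·2^l)^ν·|Ω|`. -/
theorem journe_packing (ν : ℝ) (hν : 0 < ν) :
    ∃ C : ℝ, 0 < C ∧
      ∀ ε : ℝ, ε ∈ Ioc (0:ℝ) (1/4) →
        ∀ Ω : Set (ℝ × ℝ), IsOpen Ω → 0 < volume Ω → volume Ω < ⊤ →
          ∀ l : ℕ, 1 ≤ l → ((2:ℝ) ^ (2 * l))⁻¹ ≤ 16 * ε →
            (∑' s : {q : (ℤ × ℤ) × ℤ × ℤ //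
                IsMaximalIn Ω q ∧
                dyadRectDil (2 ^ l) q ⊆ enlarge (enlarge Ω ε) ε ∧
                ¬ dyadRectDil (2 ^ (l+1)) q ⊆ enlarge (enlarge Ω ε) ε},
              volume (dyadRect s.1)) ≤
            ENNReal.ofReal (C * (Real.sqrt ε * 2 ^ l) ^ ν) * volume Ω := by
  have hlog : 0 < Real.log 2 := Real.log_pos one_lt_two
  refine ⟨34 * (32 ^ ν / (ν * Real.log 2)), by positivity, ?_⟩
  intro ε hε Ω hΩ _ _ l _ hl
  have hx0 : 0 ≤ √ε * 2 ^ l := by positivity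
  have hx : 1 ≤ 16 * (√ε * 2 ^ l) := by
    have h1 : 1 ≤ 16 * (√ε * 2 ^ l) ^ 2 := by
      rw [mul_pow, Real.sq_sqrt hε.1.le, ← pow_mul, mul_comm l 2, ← mul_assoc]
      exact (inv_le_iff_one_le_mul₀ (by positivity)).1 hl
    nlinarith
  obtain ⟨n, hn1, hn2⟩ := exists_nat_pow_near hx (one_lt_two (α := ℝ))
  have hk : ((n + 1 : ℕ) : ℝ) ≤ 32 ^ ν / (ν * Real.log 2) * (√ε * 2 ^ l) ^ ν := by
    refine natCast_le_rpow hν _ hx0 ?_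
    rw [pow_succ]
    linarith
  rw [ENNReal.tsum_eq_iSup_sum]
  refine iSup_le fun T => ?_
  have hT := sum_volume_le_of_half_halfRects hΩ.measurableSet n.succ_pos
    (T.map (Function.Embedding.subtype _)) ?_ ?_
  · rw [Finset.sum_map] at hT
    refine hT.trans (mul_le_mul_left ?_ _)
    rw [mul_assoc, ENNReal.ofReal_mul (by norm_num : (0:ℝ) ≤ 34), ENNReal.ofReal_ofNat]
    refine mul_le_mul_right ?_ _
    rw [← ENNReal.ofReal_natCast]
    exact ENNReal.ofReal_le_ofReal hk
  · rw [Finset.forall_mem_map]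
    exact fun s _ => s.2.1
  · rw [Finset.forall_mem_map]
    intro s _
    by_contra! hlt
    exact s.2.2.2 (dyadRectDil_subset_of_half hΩ.measurableSet hε hn2.le hlt)
end
end
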